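/- arXiv:2207.03354 — 3 statements merged into one kernel-verified Lean document; each statement's English description precedes it below -/
import Mathlib

section
/- Let k ≤ n be nonnegative integers and let μ ⊆ λ be strict partitions with ℓ(λ) ≤ n. Then Q^{(k,n−k)}_{λ/μ}(x₁,…,xₙ) = Σ Π_{i=1}^k π_C^(1)(Q^C_{μ^(i)/μ^(i−1)})(x_i) · Π_{j=k+1}^n π_A^(1)(Q^A_{μ^(j)/μ^(j−1)})(x_j), where the sum is over all chains of strict partitions μ = μ^(0) ⊆ μ^(1) ⊆ ⋯ ⊆ μ^(n−1) ⊆ μ^(n) = λ, and π_C^(1)(·)(x_i), π_A^(1)(·)(x_j) denote the one-variable specializations with the single variable renamed x_i, respectively x_j. -/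
open MvPolynomial

noncomputable section

abbrev SymF : Type := MvPolynomial ℕ ℚ

/-- A partition, as a weakly decreasing function `ℕ → ℕ` (0-indexed parts)
that eventually vanishes. -/
structure Partn where
  part : ℕ → ℕ
  antitone' : ∀ i, part (i + 1) ≤ part i
  exists_zero : ∃ N, part N = 0

/-- The length (number of nonzero parts) of a partition. -/
def Partn.len (l : Partn) : ℕ := Nat.find l.exists_zero

/-- Containment of partitions (of their Young diagrams). -/
def Partn.Sub (mu lam : Partn) : Prop := ∀ i, mu.part i ≤ lam.part i

/-- The empty partition. -/
def Partn.empty : Partn := ⟨fun _ => 0, fun _ => le_rfl, ⟨0, rfl⟩⟩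

/-- A strict partition: strictly decreasing positive parts. -/
structure SPartn where
  part : ℕ → ℕ
  strict' : ∀ i, part (i + 1) ≠ 0 → part (i + 1) < part i
  exists_zero : ∃ N, part N = 0

/-- The length (number of nonzero parts) of a strict partition. -/
def SPartn.len (l : SPartn) : ℕ := Nat.find l.exists_zero

/-- Containment of strict partitions. -/
def SPartn.Sub (mu lam : SPartn) : Prop := ∀ i, mu.part i ≤ lam.part i

/-- The empty strict partition. -/
def SPartn.empty : SPartn := ⟨fun _ => 0, fun _ h => absurd rfl h, ⟨0, rfl⟩⟩

/-- The one-row strict partition `(a)`. -/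
def SPartn.single (a : ℕ) : SPartn :=
  ⟨fun i => if i = 0 then a else 0,
   fun i h => absurd (if_neg (Nat.succ_ne_zero i)) h, ⟨1, rfl⟩⟩

/-- The two-row strict partition `(a, b)` with `b < a` (allowing `b = 0`). -/
def SPartn.two (a b : ℕ) (h : b < a) : SPartn :=
  ⟨fun i => if i = 0 then a else if i = 1 then b else 0,
   by
    intro i hi
    match i with
    | 0 => simpa using h
    | (n+1) => simp at hi,
   ⟨2, rfl⟩⟩

/-- Parts of a strict partition are strictly decreasing within its length. -/
theorem SPartn.part_lt (s : SPartn) {i j : ℕ} (hij : i < j) (hj : j < s.len) :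
    s.part j < s.part i := by
  have hjne : s.part j ≠ 0 := Nat.find_min s.exists_zero hj
  have key : ∀ d i, s.part (i + d + 1) ≠ 0 → s.part (i + d + 1) < s.part i := by
    intro d
    induction d with
    | zero => intro i hI; simpa using s.strict' i (by simpa using hI)
    | succ d ih =>
      intro i hI
      have h1 : s.part (i + d + 1 + 1) < s.part (i + d + 1) := s.strict' (i + d + 1) hI
      have h2 : s.part (i + d + 1) ≠ 0 := by omega
      exact lt_trans h1 (ih i h2)
  have hj' : i + (j - i - 1) + 1 = j := by omega
  rw [← hj'] at hjne ⊢
  exact key _ i hjne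


noncomputable section


/-- `q_r ∈ Λ`, determined by `q_0 = 1` and the recursion
`r·q_r = 2·Σ_{1 ≤ i ≤ r, i odd} p_i·q_{r−i}` (here `X i` is `p_{i+1}`). -/
def qSym : ℕ → SymF
  | 0 => 1
  | (r + 1) =>
      (((r : ℚ) + 1))⁻¹ • (2 * ∑ i ∈ Finset.range (r + 1),
        if Odd (i + 1) then X i * qSym (r - i) else 0)
  decreasing_by exact Nat.lt_succ_of_le (Nat.sub_le r i)

/-- `q_r` for `r ∈ ℤ`, with `q_r = 0` for `r < 0`. -/
def qZ (z : ℤ) : SymF := if 0 ≤ z then qSym z.toNat else 0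

/-- `h_r ∈ Λ`, determined by `h_0 = 1` and the Newton recursion
`r·h_r = Σ_{i=1}^r p_i·h_{r−i}` (here `X i` is `p_{i+1}`). -/
def hSym : ℕ → SymF
  | 0 => 1
  | (r + 1) =>
      (((r : ℚ) + 1))⁻¹ • (∑ i ∈ Finset.range (r + 1), X i * hSym (r - i))
  decreasing_by exact Nat.lt_succ_of_le (Nat.sub_le r i)

/-- `h_r` for `r ∈ ℤ`, with `h_r = 0` for `r < 0`. -/
def hZ (z : ℤ) : SymF := if 0 ≤ z then hSym z.toNat else 0

/-- `Q^A_{(r,s)}` for `r > s`. -/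
def QA2core (r s : ℕ) : SymF :=
  qSym r * qSym s +
    2 * ∑ t ∈ Finset.Icc 1 s, (-1 : SymF) ^ t * (qZ ((r : ℤ) + t) * qZ ((s : ℤ) - t))

/-- Schur's `Q`-function of a two-row diagram, `Q^A_{(r,s)}`, with the conventions
`Q^A_{(r,0)} = q_r`, `Q^A_{(r,r)} = 0`, `Q^A_{(s,r)} = −Q^A_{(r,s)}`. -/
def QA2 (r s : ℕ) : SymF :=
  if s < r then QA2core r s else if r < s then -QA2core s r else 0

/-- `Q^C_{(r,s)}` for `r > s`. -/
def QC2core (r s : ℕ) : SymF :=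
  qSym r * qSym s +
    2 * ∑ t ∈ Finset.Icc 1 s, (-1 : SymF) ^ t *
      ((qZ ((r : ℤ) + t) + 2 * (∑ i ∈ Finset.Icc 1 (t - 1), qZ ((r : ℤ) + t - 2 * i))
          + qZ ((r : ℤ) - t)) * qZ ((s : ℤ) - t))

/-- The symplectic `Q`-function of a two-row diagram, `Q^C_{(r,s)}`, with the same
conventions as in the type `A` case. -/
def QC2 (r s : ℕ) : SymF :=
  if s < r then QC2core r s else if r < s then -QC2core s r else 0

/-- The Pfaffian `Pf(B) = (2^m m!)⁻¹ Σ_σ sgn(σ) Π_t B_{σ(2t−1),σ(2t)}`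
of an `N × N` matrix (intended for skew-symmetric `B` with `N` even, `N = 2m`). -/
def Pf {R : Type*} [CommRing R] [Algebra ℚ R] {N : ℕ}
    (B : Matrix (Fin N) (Fin N) R) : R :=
  (((2 : ℚ) ^ (N / 2) * (N / 2).factorial))⁻¹ •
    ∑ σ : Equiv.Perm (Fin N),
      ((Equiv.Perm.sign σ : ℤˣ) : ℤ) •
        ∏ t ∈ (Finset.range (N / 2)).attach,
          B (σ ⟨2 * t.1, by have := Finset.mem_range.mp t.2; omega⟩)
            (σ ⟨2 * t.1 + 1, by have := Finset.mem_range.mp t.2; omega⟩)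

/-- The skew `Q`-function `Q^X_{λ/μ}` (for `X = A, C` according to the two-row
function `Q2`), defined as the Pfaffian of the block matrix
`[[M^X_λ, N_{λ,μ}], [−N_{λ,μ}ᵀ, O]]`, where `μ` is padded with a zero part
whenever `ℓ(λ) + ℓ(μ)` is odd. -/
def skewQ (Q2 : ℕ → ℕ → SymF) (lam mu : SPartn) : SymF :=
  let l := lam.len
  let m := if Even (l + mu.len) then mu.len else mu.len + 1
  Pf (N := l + m) (Matrix.of fun i j =>
    if _hi : (i : ℕ) < l then
      if _hj : (j : ℕ) < l then Q2 (lam.part i) (lam.part j)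
      else qZ ((lam.part i : ℤ) - mu.part (m - 1 - ((j : ℕ) - l)))
    else
      if _hj : (j : ℕ) < l then - qZ ((lam.part j : ℤ) - mu.part (m - 1 - ((i : ℕ) - l)))
      else 0)

/-- The skew Schur `Q`-function `Q^A_{λ/μ}`. -/
def QAskew (lam mu : SPartn) : SymF := skewQ QA2 lam mu

/-- The skew symplectic `Q`-function `Q^C_{λ/μ}`. -/
def QCskew (lam mu : SPartn) : SymF := skewQ QC2 lam mu

/-- Laurent polynomials in `k` variables. -/
abbrev Laur (k : ℕ) : Type := AddMonoidAlgebra ℚ (Fin k →₀ ℤ)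

/-- The Laurent monomial `x_i ^ z`. -/
def lX {k : ℕ} (i : Fin k) (z : ℤ) : Laur k :=
  AddMonoidAlgebra.single (Finsupp.single i z) 1

/-- `π_A^{(n)} : Λ → ℚ[x₁,…,xₙ]`, `p_r ↦ x₁^r + ⋯ + xₙ^r`. -/
def piA (n : ℕ) : SymF →ₐ[ℚ] MvPolynomial (Fin n) ℚ :=
  aeval fun r => ∑ i : Fin n, X i ^ (r + 1)

/-- `π_C^{(n)} : Λ → ℚ[x₁^{±1},…,xₙ^{±1}]`, `p_r ↦ Σ (x_i^r + x_i^{-r})`. -/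
def piC (n : ℕ) : SymF →ₐ[ℚ] Laur n :=
  aeval fun r => ∑ i : Fin n, (lX i ((r : ℤ) + 1) + lX i (-((r : ℤ) + 1)))

/-- `ℚ[x₁^{±1},…,x_k^{±1}][x_{k+1},…,xₙ]` (with `m = n − k` type-`A` variables). -/
abbrev IRing (k m : ℕ) : Type := MvPolynomial (Fin m) (Laur k)

/-- `π_A^{(n-k)}` with the variables renamed `x_{k+1}, …, x_n`, landing in
`ℚ[x₁^{±1},…,x_k^{±1}][x_{k+1},…,xₙ]`: `p_r ↦ x_{k+1}^r + ⋯ + x_n^r`. -/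
def piAupper (k n : ℕ) : SymF →ₐ[ℚ] IRing k (n - k) :=
  aeval fun r => ∑ j : Fin (n - k), (X j : IRing k (n - k)) ^ (r + 1)

open scoped Classical in
/-- The intermediate symplectic `Q`-polynomial
`Q^{(k,n−k)}_{λ/μ}(x₁,…,xₙ) = Σ_ν π_C^{(k)}(Q^C_{ν/μ}) · π_A^{(n−k)}(Q^A_{λ/ν})`,
the sum being over all strict partitions `ν` with `μ ⊆ ν ⊆ λ`. -/
def interQ (k n : ℕ) (lam mu : SPartn) : IRing k (n - k) :=
  ∑ᶠ (ν : SPartn) (_ : mu.Sub ν ∧ ν.Sub lam),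
    C (piC k (QCskew ν mu)) * piAupper k n (QAskew lam ν)

/-- One-variable type-`C` specialization placed at the variable `x_i` (`1 ≤ i ≤ k`):
`p_r ↦ x_i^r + x_i^{−r}`. -/
def piC1at (k n : ℕ) (i : Fin k) : SymF →ₐ[ℚ] IRing k (n - k) :=
  aeval fun r => MvPolynomial.C (lX i ((r : ℤ) + 1) + lX i (-((r : ℤ) + 1)))

/-- One-variable type-`A` specialization placed at the variable `x_{k+1+j}`:
`p_r ↦ x_{k+1+j}^r`. -/
def piA1at (k n : ℕ) (j : Fin (n - k)) : SymF →ₐ[ℚ] IRing k (n - k) :=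
  aeval fun r => (X j : IRing k (n - k)) ^ (r + 1)

noncomputable section
open MvPolynomial

namespace PfX
open ExteriorAlgebra

variable {R : Type*} [CommRing R] {V W : Type*} [AddCommGroup V] [Module R V]
  [AddCommGroup W] [Module R W]

/-- contraction on the exterior algebra -/
def ct (d : Module.Dual R V) : ExteriorAlgebra R V →ₗ[R] ExteriorAlgebra R V :=
  CliffordAlgebra.contractLeft (Q := (0 : QuadraticForm R V)) d

theorem ct_ι_mul (d : Module.Dual R V) (v : V) (x : ExteriorAlgebra R V) :
    ct d (ι R v * x) = d v • x - ι R v * ct d x :=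
  CliffordAlgebra.contractLeft_ι_mul (Q := (0 : QuadraticForm R V)) d v x

theorem ct_algebraMap (d : Module.Dual R V) (r : R) :
    ct d (algebraMap R (ExteriorAlgebra R V) r) = 0 :=
  CliffordAlgebra.contractLeft_algebraMap (Q := (0 : QuadraticForm R V)) d r

theorem ct_one (d : Module.Dual R V) : ct d (1 : ExteriorAlgebra R V) = 0 :=
  CliffordAlgebra.contractLeft_one (Q := (0 : QuadraticForm R V)) d

theorem ct_comm (d d' : Module.Dual R V) (x : ExteriorAlgebra R V) :
    ct d (ct d' x) = - ct d' (ct d x) :=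
  CliffordAlgebra.contractLeft_comm (Q := (0 : QuadraticForm R V)) d d' x

theorem ct_ct (d : Module.Dual R V) (x : ExteriorAlgebra R V) : ct d (ct d x) = 0 :=
  CliffordAlgebra.contractLeft_contractLeft (Q := (0 : QuadraticForm R V)) d x

theorem ct_add (d d' : Module.Dual R V) (x : ExteriorAlgebra R V) :
    ct (d + d') x = ct d x + ct d' x := by
  unfold ct; rw [map_add]; rfl

theorem ct_neg (d : Module.Dual R V) (x : ExteriorAlgebra R V) :
    ct (-d) x = - ct d x := by
  unfold ct; rw [map_neg]; rfl

theorem ct_zero (x : ExteriorAlgebra R V) : ct (0 : Module.Dual R V) x = 0 := by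
  unfold ct; rw [map_zero]; rfl

theorem cf_aux (B : LinearMap.BilinForm R V) (h : ∀ v, B v v = 0) :
    (-B).toQuadraticMap = (0 : QuadraticForm R V) - 0 := by
  ext v; simp [h]

/-- exponential of contraction by a two-form -/
def cf (B : LinearMap.BilinForm R V) (h : ∀ v, B v v = 0) :
    ExteriorAlgebra R V →ₗ[R] ExteriorAlgebra R V :=
  CliffordAlgebra.changeForm (Q := (0 : QuadraticForm R V)) (Q' := (0 : QuadraticForm R V))
    (B := -B) (cf_aux B h)

theorem cf_ι_mul (B : LinearMap.BilinForm R V) (h : ∀ v, B v v = 0) (v : V)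
    (x : ExteriorAlgebra R V) :
    cf B h (ι R v * x) = ι R v * cf B h x + ct (B v) (cf B h x) := by
  have := CliffordAlgebra.changeForm_ι_mul (Q := (0 : QuadraticForm R V))
    (Q' := (0 : QuadraticForm R V)) (B := -B) (cf_aux B h) v x
  refine this.trans ?_
  have h2 := ct_neg (B v) (cf B h x)
  change _ - ct (-(B v)) (cf B h x) = _
  rw [h2, sub_neg_eq_add]; rfl

theorem cf_algebraMap (B : LinearMap.BilinForm R V) (h : ∀ v, B v v = 0) (r : R) :
    cf B h (algebraMap R _ r) = algebraMap R _ r :=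
  CliffordAlgebra.changeForm_algebraMap (cf_aux B h) r

theorem cf_one (B : LinearMap.BilinForm R V) (h : ∀ v, B v v = 0) :
    cf B h 1 = 1 :=
  CliffordAlgebra.changeForm_one (cf_aux B h)

theorem cf_ct (B : LinearMap.BilinForm R V) (h : ∀ v, B v v = 0) (d : Module.Dual R V)
    (x : ExteriorAlgebra R V) : cf B h (ct d x) = ct d (cf B h x) :=
  CliffordAlgebra.changeForm_contractLeft (cf_aux B h) d x

@[elab_as_elim]
theorem ext_ind {P : ExteriorAlgebra R V → Prop}
    (h0 : ∀ r, P (algebraMap R _ r)) (hadd : ∀ x y, P x → P y → P (x + y))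
    (hmul : ∀ x v, P x → P (ι R v * x)) (x : ExteriorAlgebra R V) : P x :=
  CliffordAlgebra.left_induction (Q := (0 : QuadraticForm R V)) h0 hadd hmul x

theorem cf_cf (B B' : LinearMap.BilinForm R V) (h : ∀ v, B v v = 0) (h' : ∀ v, B' v v = 0)
    (h'' : ∀ v, (B + B') v v = 0)
    (x : ExteriorAlgebra R V) : cf B' h' (cf B h x) = cf (B + B') h'' x := by
  induction x using ext_ind with
  | h0 r => simp [cf_algebraMap]
  | hadd x y hx hy => simp [hx, hy]
  | hmul x v hx =>
    simp only [cf_ι_mul, map_add, hx, LinearMap.add_apply, ct_add, cf_ct]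
    abel

theorem cf_zero (h : ∀ v, (0 : LinearMap.BilinForm R V) v v = 0) (x : ExteriorAlgebra R V) :
    cf 0 h x = x := by
  induction x using ext_ind with
  | h0 r => simp [cf_algebraMap]
  | hadd x y hx hy => simp [hx, hy]
  | hmul x v hx => simp [cf_ι_mul, hx, ct_zero]

theorem ct_map (T : V →ₗ[R] W) (d : Module.Dual R W) (x : ExteriorAlgebra R V) :
    ct d (map T x) = map T (ct (d ∘ₗ T) x) := by
  induction x using ext_ind with
  | h0 r => simp [ct_algebraMap]
  | hadd x y hx hy => simp [hx, hy]
  | hmul x v hx => simp [ct_ι_mul, hx]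

theorem cf_map (T : V →ₗ[R] W) (B : LinearMap.BilinForm R W) (h : ∀ v, B v v = 0)
    (B' : LinearMap.BilinForm R V) (h' : ∀ v, B' v v = 0)
    (hB : ∀ v w, B' v w = B (T v) (T w)) (x : ExteriorAlgebra R V) :
    cf B h (map T x) = map T (cf B' h' x) := by
  induction x using ext_ind with
  | h0 r => simp [cf_algebraMap]
  | hadd x y hx hy => simp [hx, hy]
  | hmul x v hx =>
    have : B' v = B (T v) ∘ₗ T := by ext w; simp [hB]
    simp [cf_ι_mul, hx, this, ct_map]

/-- the degree zero part -/
abbrev eps : ExteriorAlgebra R V →ₐ[R] R := algebraMapInv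

theorem eps_ι_mul (v : V) (x : ExteriorAlgebra R V) : eps (ι R v * x) = 0 := by
  rw [map_mul]; simp [eps, algebraMapInv]

theorem eps_map (T : V →ₗ[R] W) (x : ExteriorAlgebra R V) : eps (map T x) = eps x := by
  induction x using ext_ind with
  | h0 r => simp
  | hadd x y hx hy => simp [hx, hy]
  | hmul x v hx => simp [eps_ι_mul, -map_mul, map_mul (map T)]

theorem ι_swap (u v : V) : ι R u * ι R v = - (ι R v * ι R u) :=
  eq_neg_of_add_eq_zero_left (ι_add_mul_swap u v)

theorem ι_swap_mul (u v : V) (x : ExteriorAlgebra R V) :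
    ι R u * (ι R v * x) = - (ι R v * (ι R u * x)) := by
  rw [← mul_assoc, ι_swap, neg_mul, mul_assoc]

/-- wedge of a list of vectors -/
def pr (L : List V) : ExteriorAlgebra R V := (L.map (ι R)).prod

@[simp] theorem pr_nil : pr ([] : List V) = (1 : ExteriorAlgebra R V) := rfl
@[simp] theorem pr_cons (v : V) (L : List V) :
    pr (v :: L) = (ι R v * pr L : ExteriorAlgebra R V) := by simp [pr]
theorem pr_append (L L' : List V) :
    pr (L ++ L') = (pr L * pr L' : ExteriorAlgebra R V) := by simp [pr]

theorem map_pr (T : V →ₗ[R] W) (L : List V) : map T (pr L) = pr (L.map T) := by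
  induction L with
  | nil => simp
  | cons a L ih => simp [ih]

theorem ι_mul_pr (v : V) (L : List V) :
    ι R v * pr L = (-1 : R) ^ L.length • (pr L * ι R v) := by
  induction L with
  | nil => simp
  | cons a L ih =>
    rw [pr_cons, ι_swap_mul, ih]
    simp [pow_succ, mul_assoc]

theorem pr_mul_pr (L K : List V) :
    (pr L * pr K : ExteriorAlgebra R V) = (-1 : R) ^ (L.length * K.length) • (pr K * pr L) := by
  induction L with
  | nil => simp
  | cons a L ih =>
    rw [pr_cons, mul_assoc, ih, mul_smul_comm, ← mul_assoc, ι_mul_pr]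
    rw [List.length_cons, smul_mul_assoc, smul_smul, mul_assoc]
    congr 1
    ring

theorem ct_pr_mul (d : Module.Dual R V) (L : List V) (y : ExteriorAlgebra R V) :
    ct d (pr L * y) = (∑ k : Fin L.length, ((-1 : R) ^ (k : ℕ) * d L[k]) • (pr (L.eraseIdx k) * y))
      + (-1 : R) ^ L.length • (pr L * ct d y) := by
  induction L with
  | nil => simp
  | cons a L ih =>
    rw [pr_cons, mul_assoc, ct_ι_mul, ih]
    simp only [List.length_cons]
    rw [Fin.sum_univ_succ]
    simp only [mul_add, Finset.mul_sum]
    simp [pow_succ, mul_assoc, sub_eq_add_neg, add_assoc]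
    exact add_comm _ _

end PfX
end

noncomputable section
open MvPolynomial

namespace PfX
open ExteriorAlgebra

variable {R : Type*} [CommRing R] {V W : Type*} [AddCommGroup V] [Module R V]
  [AddCommGroup W] [Module R W]

/-- Pfaffian of a list of vectors for an alternating form -/
def gP (ω : LinearMap.BilinForm R W) (h : ∀ v, ω v v = 0) (L : List W) : R :=
  eps (cf ω h (pr L))

theorem gP_cons (ω : LinearMap.BilinForm R W) (h : ∀ v, ω v v = 0) (a : W) (L : List W) :
    gP ω h (a :: L) = ∑ k : Fin L.length, (-1 : R) ^ (k : ℕ) * ω a L[k] *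
      gP ω h (L.eraseIdx k) := by
  unfold gP
  rw [pr_cons, cf_ι_mul, map_add, eps_ι_mul, zero_add, ← cf_ct]
  have := ct_pr_mul (ω a) L 1
  simp only [mul_one, ct_one, mul_zero, smul_zero, add_zero] at this
  rw [this]
  simp [map_sum]

theorem gP_perm (ω : LinearMap.BilinForm R W) (h : ∀ v, ω v v = 0) {N : ℕ} (v : Fin N → W)
    (σ : Equiv.Perm (Fin N)) :
    gP ω h (List.ofFn fun i => v (σ i)) =
      ((Equiv.Perm.sign σ : ℤˣ) : ℤ) • gP ω h (List.ofFn v) := by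
  have key : ∀ w : Fin N → W, (pr (List.ofFn w) : ExteriorAlgebra R W) = ιMulti R N w := by
    intro w
    rw [ιMulti_apply, pr, List.map_ofFn]; rfl
  unfold gP
  rw [key, key]
  have := (ιMulti R N (M := W)).map_perm v σ
  have h2 : (ιMulti R N) (fun i => v (σ i)) = ((Equiv.Perm.sign σ : ℤˣ) : ℤ) • ιMulti R N v := this
  rw [h2, map_zsmul, map_zsmul]

/-- partial expansion term -/
def Ft (ω : LinearMap.BilinForm R W) (h : ∀ v, ω v v = 0) {N : ℕ} (v : Fin N → W) (t : ℕ)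
    (σ : Equiv.Perm (Fin N)) : R :=
  ((Equiv.Perm.sign σ : ℤˣ) : ℤ) •
    ((∏ i ∈ Finset.range t,
      if hi : 2 * i + 1 < N then ω (v (σ ⟨2 * i, by omega⟩)) (v (σ ⟨2 * i + 1, hi⟩)) else 0) *
    gP ω h ((List.ofFn fun i => v (σ i)).drop (2 * t)))

theorem cyc_fix {N : ℕ} (a b c : Fin N) (h : c < a) :
    (Fin.cycleIcc a b)⁻¹ c = c := by
  rw [Equiv.Perm.inv_eq_iff_eq, Fin.cycleIcc_of_lt h]

theorem cyc_first {N : ℕ} (a b : Fin N) (h : a ≤ b) :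
    (Fin.cycleIcc a b)⁻¹ a = b := by
  have : NeZero N := ⟨by have := a.2; omega⟩
  rw [Equiv.Perm.inv_eq_iff_eq, Fin.cycleIcc_of_last h]

theorem cyc_mid {N : ℕ} (a b : Fin N) (c : ℕ) (h : (a : ℕ) ≤ c) (h2 : c < b) :
    (Fin.cycleIcc a b)⁻¹ ⟨c + 1, by omega⟩ = ⟨c, by omega⟩ := by
  have : NeZero N := ⟨by have := a.2; omega⟩
  rw [Equiv.Perm.inv_eq_iff_eq, Fin.cycleIcc_of_ge_of_lt (by simpa [Fin.le_def] using h)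
    (by simpa [Fin.lt_def] using h2)]
  ext
  rw [Fin.val_add_one_of_lt' (by simp; omega)]

theorem cyc_last {N : ℕ} (a b c : Fin N) (h : b < c) :
    (Fin.cycleIcc a b)⁻¹ c = c := by
  rw [Equiv.Perm.inv_eq_iff_eq, Fin.cycleIcc_of_gt h]

theorem Ft_step (ω : LinearMap.BilinForm R W) (h : ∀ v, ω v v = 0) {N : ℕ} (v : Fin N → W)
    (t : ℕ) (ht : 2 * t + 1 < N) :
    ∑ σ, Ft ω h v t σ = ((N - 2 * t - 1 : ℕ) : R) * ∑ σ, Ft ω h v (t + 1) σ := by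
  have hlen : ∀ σ : Equiv.Perm (Fin N),
      ((List.ofFn fun i => v (σ i)).drop (2 * t + 1)).length = N - 2 * t - 1 := by
    intro σ; simp; omega
  have e1 : ∀ σ, Ft ω h v t σ = ∑ k : Fin (N - 2 * t - 1),
      Ft ω h v (t + 1) (σ * (Fin.cycleIcc ⟨2 * t + 1, ht⟩ ⟨2 * t + 1 + k, by omega⟩)⁻¹) := by
    intro σ
    have hd : (List.ofFn fun i => v (σ i)).drop (2 * t) = v (σ ⟨2 * t, by omega⟩) ::
        (List.ofFn fun i => v (σ i)).drop (2 * t + 1) := by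
      rw [List.drop_eq_getElem_cons (by simp; omega)]
      simp
    unfold Ft
    rw [hd, gP_cons]
    rw [← (finCongr (hlen σ).symm).sum_comp, Finset.mul_sum, Finset.smul_sum]
    refine Finset.sum_congr rfl fun k _ => ?_
    set c : Equiv.Perm (Fin N) :=
      (Fin.cycleIcc ⟨2 * t + 1, ht⟩ ⟨2 * t + 1 + k, by omega⟩)⁻¹ with hc
    have hs : ((Equiv.Perm.sign (σ * c) : ℤˣ) : ℤ) =
        ((Equiv.Perm.sign σ : ℤˣ) : ℤ) * (-1) ^ (k : ℕ) := by
      rw [hc, Equiv.Perm.sign_mul, Equiv.Perm.sign_inv, Fin.sign_cycleIcc_of_le (by simp [Fin.le_def])]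
      simp
    have hl : (List.ofFn fun i => v ((σ * c) i)).drop (2 * (t + 1)) =
        ((List.ofFn fun i => v (σ i)).drop (2 * t + 1)).eraseIdx k := by
      apply List.ext_getElem
      · rw [List.length_eraseIdx_of_lt (by rw [hlen]; exact k.2), hlen]
        simp; omega
      · intro i h1 h2
        simp only [List.length_drop, List.length_ofFn] at h1
        rw [List.getElem_eraseIdx]
        simp only [List.getElem_drop, List.getElem_ofFn, Equiv.Perm.mul_apply]
        by_cases hik : i < k
        · have := cyc_mid (N := N) ⟨2 * t + 1, ht⟩ ⟨2 * t + 1 + k, by omega⟩ (2 * t + 1 + i)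
            (by simp) (by simpa using hik)
          simp only [hik, dif_pos]
          have e : (⟨2 * (t + 1) + i, by omega⟩ : Fin N) = ⟨2 * t + 1 + i + 1, by omega⟩ := by
            ext; simp; omega
          exact congrArg (fun z => v (σ z)) ((congrArg c e).trans this)
        · have := cyc_last (N := N) ⟨2 * t + 1, ht⟩ ⟨2 * t + 1 + k, by omega⟩
            ⟨2 * (t + 1) + i, by omega⟩ (by simp [Fin.lt_def]; omega)
          simp only [hik, dif_neg, not_false_iff]
          have e : (⟨2 * (t + 1) + i, by omega⟩ : Fin N) = ⟨2 * t + 1 + (i + 1), by omega⟩ := by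
            ext; simp; omega
          exact congrArg (fun z => v (σ z)) (this.trans e)
    rw [hs, hl, Finset.prod_range_succ, dif_pos ht]
    have hp : ∀ i ∈ Finset.range t,
        (if hi : 2 * i + 1 < N then ω (v ((σ * c) ⟨2 * i, by omega⟩))
          (v ((σ * c) ⟨2 * i + 1, hi⟩)) else 0) =
        (if hi : 2 * i + 1 < N then ω (v (σ ⟨2 * i, by omega⟩)) (v (σ ⟨2 * i + 1, hi⟩)) else 0) := by
      intro i hi
      have := Finset.mem_range.mp hi
      split_ifs with h1
      · rw [Equiv.Perm.mul_apply, Equiv.Perm.mul_apply, hc, cyc_fix, cyc_fix]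
        · simp [Fin.lt_def]; omega
        · simp [Fin.lt_def]; omega
      · rfl
    rw [Finset.prod_congr rfl hp]
    have c1 : c ⟨2 * t, by omega⟩ = ⟨2 * t, by omega⟩ := cyc_fix _ _ _ (by simp [Fin.lt_def])
    have c2 : c ⟨2 * t + 1, ht⟩ = ⟨2 * t + 1 + k, by omega⟩ := cyc_first _ _ (by simp [Fin.le_def])
    rw [Equiv.Perm.mul_apply, Equiv.Perm.mul_apply, c1, c2, mul_zsmul]
    congr 1
    simp
    ring
  simp_rw [e1]
  rw [Finset.sum_comm]
  have e2 : ∀ c : Equiv.Perm (Fin N), ∑ σ, Ft ω h v (t + 1) (σ * c) = ∑ σ, Ft ω h v (t + 1) σ :=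
    fun c => Equiv.sum_comp (Equiv.mulRight c) (fun σ => Ft ω h v (t + 1) σ)
  simp_rw [e2]
  simp

theorem fact_odd (m : ℕ) :
    (2 * m).factorial = 2 ^ m * m.factorial * ∏ i ∈ Finset.range m, (2 * m - 2 * i - 1) := by
  have h1 : ∏ i ∈ Finset.range m, (2 * m - 2 * i - 1) = ∏ i ∈ Finset.range m, (2 * i + 1) := by
    rw [← Finset.prod_range_reflect]
    refine Finset.prod_congr rfl fun i hi => ?_
    have := Finset.mem_range.mp hi
    omega
  rw [h1]
  clear h1
  induction m with
  | zero => simp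
  | succ m ih =>
    rw [show 2 * (m + 1) = 2 * m + 1 + 1 by ring, Nat.factorial_succ, Nat.factorial_succ, ih,
      Finset.prod_range_succ, Nat.factorial_succ]
    ring

theorem Pf_eq_gP [Algebra ℚ R] (ω : LinearMap.BilinForm R W) (h : ∀ v, ω v v = 0) {N : ℕ}
    (hN : Even N) (v : Fin N → W) :
    Pf (Matrix.of fun i j => ω (v i) (v j)) = gP ω h (List.ofFn v) := by
  obtain ⟨m, hm⟩ := hN
  have hm2 : N / 2 = m := by omega
  have e0 : ∑ σ, Ft ω h v 0 σ = (N.factorial : R) * gP ω h (List.ofFn v) := by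
    have : ∀ σ, Ft ω h v 0 σ = gP ω h (List.ofFn v) := by
      intro σ
      simp only [Ft, Finset.range_zero, Finset.prod_empty, one_mul, mul_zero, List.drop_zero]
      rw [gP_perm, smul_smul, Int.units_coe_mul_self, one_smul]
    simp_rw [this]
    simp [Fintype.card_perm]
  have et : ∀ t ≤ m, ∑ σ, Ft ω h v 0 σ =
      ((∏ i ∈ Finset.range t, (2 * m - 2 * i - 1) : ℕ) : R) * ∑ σ, Ft ω h v t σ := by
    intro t
    induction t with
    | zero => simp
    | succ t ih =>
      intro ht
      rw [ih (by omega), Ft_step ω h v t (by omega), Finset.prod_range_succ, Nat.cast_mul,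
        show N - 2 * t - 1 = 2 * m - 2 * t - 1 by omega, mul_assoc]
  have em : ∑ σ, Ft ω h v m σ = ∑ σ : Equiv.Perm (Fin N),
      ((Equiv.Perm.sign σ : ℤˣ) : ℤ) •
        ∏ t ∈ (Finset.range (N / 2)).attach,
          (Matrix.of fun i j => ω (v i) (v j))
            (σ ⟨2 * t.1, by have := Finset.mem_range.mp t.2; omega⟩)
            (σ ⟨2 * t.1 + 1, by have := Finset.mem_range.mp t.2; omega⟩) := by
    refine Finset.sum_congr rfl fun σ _ => ?_
    unfold Ft
    rw [List.drop_eq_nil_of_le (by simp; omega)]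
    have : gP ω h [] = 1 := by simp [gP, cf_one]
    rw [this, mul_one, show Finset.range m = Finset.range (N / 2) by rw [hm2],
      ← Finset.prod_attach]
    congr 1
    refine Finset.prod_congr rfl fun t _ => ?_
    have := Finset.mem_range.mp t.2
    rw [dif_pos (by omega)]
    rfl
  have key := et m le_rfl
  have hf : N.factorial = 2 ^ m * m.factorial * ∏ i ∈ Finset.range m, (2 * m - 2 * i - 1) := by
    rw [show N = 2 * m by omega, fact_odd]
  rw [e0, em, hf] at key
  unfold Pf
  have hm3 : ((2 : ℚ) ^ (N / 2) * (N / 2).factorial) = 2 ^ m * m.factorial := by rw [hm2]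
  rw [hm3]
  set S := ∑ σ : Equiv.Perm (Fin N),
      ((Equiv.Perm.sign σ : ℤˣ) : ℤ) •
        ∏ t ∈ (Finset.range (N / 2)).attach,
          (Matrix.of fun i j => ω (v i) (v j))
            (σ ⟨2 * t.1, by have := Finset.mem_range.mp t.2; omega⟩)
            (σ ⟨2 * t.1 + 1, by have := Finset.mem_range.mp t.2; omega⟩) with hS
  set p := ∏ i ∈ Finset.range m, (2 * m - 2 * i - 1) with hp
  have hp0 : (p : ℚ) ≠ 0 := by
    rw [Nat.cast_ne_zero, hp, Finset.prod_ne_zero_iff]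
    intro i hi
    have := Finset.mem_range.mp hi
    omega
  have k2 : (p : ℚ) • ((2 ^ m * m.factorial : ℚ) • gP ω h (List.ofFn v)) = (p : ℚ) • S := by
    have c : ∀ (n : ℕ) (x : R), (n : ℚ) • x = (n : R) * x := by
      intro n x; rw [Algebra.smul_def]; simp
    have c2 : (2 ^ m * m.factorial : ℚ) = ((2 ^ m * m.factorial : ℕ) : ℚ) := by push_cast; rfl
    rw [c2, c, c, c, ← key]
    push_cast; ring
  have k3 := smul_right_injective R hp0 k2
  have hne : (2 ^ m * m.factorial : ℚ) ≠ 0 := by positivity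
  rw [inv_smul_eq_iff₀ hne, k3]

end PfX
end

noncomputable section
open MvPolynomial

namespace PfX

/-- the product of two specializations -/
def cv {R : Type*} [CommRing R] [Algebra ℚ R] (φ ψ : SymF →ₐ[ℚ] R) : SymF →ₐ[ℚ] R :=
  aeval (fun r => φ (X r) + ψ (X r))

theorem ode_unique {R : Type*} [CommRing R] [Algebra ℚ R] (P f g : PowerSeries R)
    (hf : ∀ n : ℕ, ((n : R) + 1) * PowerSeries.coeff (n + 1) f = PowerSeries.coeff n (P * f))
    (hg : ∀ n : ℕ, ((n : R) + 1) * PowerSeries.coeff (n + 1) g = PowerSeries.coeff n (P * g))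
    (h0 : PowerSeries.coeff 0 f = PowerSeries.coeff 0 g) : f = g := by
  ext n
  induction n using Nat.strong_induction_on with
  | _ n ih =>
    cases n with
    | zero => exact h0
    | succ n =>
      have h1 : PowerSeries.coeff n (P * f) = PowerSeries.coeff n (P * g) := by
        rw [PowerSeries.coeff_mul, PowerSeries.coeff_mul]
        refine Finset.sum_congr rfl fun x hx => ?_
        have := Finset.HasAntidiagonal.mem_antidiagonal.mp hx
        rw [ih x.2 (by omega)]
      rw [← hf, ← hg] at h1
      have hn : ((n : ℚ) + 1) ≠ 0 := by positivity
      have c : ∀ x : R, ((n : ℚ) + 1) • x = ((n : R) + 1) * x := by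
        intro x; rw [Algebra.smul_def]; simp
      rw [← c, ← c] at h1
      exact smul_right_injective R hn h1

theorem qSym_rec (n : ℕ) :
    ((n : SymF) + 1) * qSym (n + 1) = 2 * ∑ i ∈ Finset.range (n + 1),
        if Odd (i + 1) then X i * qSym (n - i) else 0 := by
  rw [qSym]
  have c : ∀ x : SymF, ((n : ℚ) + 1) • x = ((n : SymF) + 1) * x := by
    intro x; rw [Algebra.smul_def]; simp
  rw [← c, smul_smul, mul_inv_cancel₀ (by positivity), one_smul]

/-- logarithmic derivative -/
def lder {R : Type*} [CommRing R] [Algebra ℚ R] (φ : SymF →ₐ[ℚ] R) : PowerSeries R :=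
  PowerSeries.mk fun i => if Odd (i + 1) then 2 * φ (X i) else 0

/-- the generating series -/
def qser {R : Type*} [CommRing R] [Algebra ℚ R] (φ : SymF →ₐ[ℚ] R) : PowerSeries R :=
  PowerSeries.mk fun i => φ (qSym i)

theorem qser_ode {R : Type*} [CommRing R] [Algebra ℚ R] (φ : SymF →ₐ[ℚ] R) (n : ℕ) :
    ((n : R) + 1) * PowerSeries.coeff (n + 1) (qser φ) =
      PowerSeries.coeff n (lder φ * qser φ) := by
  have := congrArg φ (qSym_rec n)
  simp only [map_mul, map_add, map_natCast, map_one, map_sum, apply_ite φ, map_zero, map_ofNat]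
    at this
  rw [qser, PowerSeries.coeff_mk, this, PowerSeries.coeff_mul,
    Finset.Nat.sum_antidiagonal_eq_sum_range_succ_mk, Finset.mul_sum]
  refine Finset.sum_congr rfl fun i _ => ?_
  simp only [lder, PowerSeries.coeff_mk]
  split_ifs <;> ring

theorem ode_deriv {R : Type*} [CommRing R] (P f : PowerSeries R) :
    (∀ n : ℕ, ((n : R) + 1) * PowerSeries.coeff (n + 1) f = PowerSeries.coeff n (P * f)) ↔
    PowerSeries.derivative R f = P * f := by
  rw [PowerSeries.ext_iff]
  refine forall_congr' fun n => ?_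
  rw [PowerSeries.coeff_derivative, mul_comm]

theorem qser_cv {R : Type*} [CommRing R] [Algebra ℚ R] (φ ψ : SymF →ₐ[ℚ] R) :
    qser (cv φ ψ) = qser φ * qser ψ := by
  refine ode_unique (lder (cv φ ψ)) _ _ (qser_ode _) ?_ ?_
  · rw [ode_deriv, Derivation.leibniz, (ode_deriv _ _).1 (qser_ode φ),
      (ode_deriv _ _).1 (qser_ode ψ)]
    have : lder (cv φ ψ) = lder φ + lder ψ := by
      ext n
      simp only [lder, PowerSeries.coeff_mk, map_add, cv, aeval_X]
      split_ifs <;> ring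
    rw [this, smul_eq_mul, smul_eq_mul]; ring
  · simp only [qser, PowerSeries.coeff_mul, PowerSeries.coeff_mk]
    simp [qSym]

theorem qser_neg :
    qser (AlgHom.id ℚ SymF) * (PowerSeries.mk fun n => (-1) ^ n * qSym n) = 1 := by
  refine ode_unique 0 _ _ ?_ ?_ ?_
  · rw [ode_deriv, Derivation.leibniz, (ode_deriv _ _).1 (qser_ode _)]
    have : PowerSeries.derivative SymF (PowerSeries.mk fun n => (-1) ^ n * qSym n) =
        (- lder (AlgHom.id ℚ SymF)) * (PowerSeries.mk fun n => (-1) ^ n * qSym n) := by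
      rw [← ode_deriv]
      intro n
      rw [PowerSeries.coeff_mk, mul_left_comm, qSym_rec, PowerSeries.coeff_mul,
        Finset.Nat.sum_antidiagonal_eq_sum_range_succ_mk, Finset.mul_sum, Finset.mul_sum]
      refine Finset.sum_congr rfl fun i hi => ?_
      simp only [lder, PowerSeries.coeff_mk, map_neg]
      have hi := Finset.mem_range.mp hi
      split_ifs with ho
      · have : (-1 : SymF) ^ (n + 1) = - (-1) ^ (n - i) := by
          have e : n + 1 = (n - i) + (i + 1) := by omega
          rw [e, pow_add, ho.neg_one_pow]; ring
        rw [this]; simp; ring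
      · simp
    rw [this, smul_eq_mul, smul_eq_mul]; ring
  · intro n; simp [PowerSeries.coeff_one]
  · simp [qser, qSym]

theorem qq_zero (n : ℕ) (hn : n ≠ 0) :
    ∑ i ∈ Finset.range (n + 1), (-1 : SymF) ^ i * (qSym i * qSym (n - i)) = 0 := by
  have := congrArg (PowerSeries.coeff n) qser_neg
  rw [mul_comm, PowerSeries.coeff_mul, Finset.Nat.sum_antidiagonal_eq_sum_range_succ_mk,
    PowerSeries.coeff_one, if_neg hn] at this
  simp only [qser, PowerSeries.coeff_mk] at this
  rw [← this]
  refine Finset.sum_congr rfl fun i _ => ?_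
  simp; ring

@[simp] theorem qZ_nat (n : ℕ) : qZ (n : ℤ) = qSym n := by simp [qZ]

theorem qZ_of (z : ℤ) (n : ℕ) (h : z = n) : qZ z = qSym n := by rw [h, qZ_nat]

theorem sum_Icc_one {M : Type*} [AddCommMonoid M] (s : ℕ) (f : ℕ → M) :
    ∑ t ∈ Finset.Icc 1 s, f t = ∑ t ∈ Finset.range s, f (t + 1) := by
  induction s with
  | zero => simp
  | succ s ih => rw [Finset.sum_Icc_succ_top (by omega), ih, Finset.sum_range_succ]

theorem QA2core_eq (r s : ℕ) : QA2core r s = qSym r * qSym s +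
    2 * ∑ t ∈ Finset.range s, (-1 : SymF) ^ (t + 1) * (qSym (r + (t + 1)) * qSym (s - (t + 1))) := by
  rw [QA2core, sum_Icc_one]
  congr 2
  refine Finset.sum_congr rfl fun t ht => ?_
  have := Finset.mem_range.mp ht
  rw [qZ_of _ (r + (t + 1)) (by push_cast; ring), qZ_of _ (s - (t + 1)) (by omega)]

theorem QA2core_rec (r s : ℕ) : QA2core r (s + 1) + QA2core (r + 1) s =
    qSym r * qSym (s + 1) - qSym (r + 1) * qSym s := by
  rw [QA2core_eq, QA2core_eq, Finset.sum_range_succ']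
  have : ∀ t ∈ Finset.range s,
      (-1 : SymF) ^ (t + 1 + 1) * (qSym (r + (t + 1 + 1)) * qSym (s + 1 - (t + 1 + 1))) =
      - ((-1 : SymF) ^ (t + 1) * (qSym (r + 1 + (t + 1)) * qSym (s - (t + 1)))) := by
    intro t ht
    rw [show r + (t + 1 + 1) = r + 1 + (t + 1) by ring,
      show s + 1 - (t + 1 + 1) = s - (t + 1) by omega]
    ring
  rw [Finset.sum_congr rfl this, Finset.sum_neg_distrib]
  simp
  ring

theorem QA2core_diag (r : ℕ) (hr : r ≠ 0) : QA2core r r = 0 := by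
  have h := qq_zero (2 * r) (by omega)
  rw [QA2core_eq]
  have e : ∑ i ∈ Finset.range (2 * r + 1), (-1 : SymF) ^ i * (qSym i * qSym (2 * r - i)) =
      (-1) ^ r * (qSym r * qSym r +
    2 * ∑ t ∈ Finset.range r, (-1 : SymF) ^ (t + 1) * (qSym (r + (t + 1)) * qSym (r - (t + 1)))) := by
    rw [show 2 * r + 1 = r + (r + 1) by ring, Finset.sum_range_add, Finset.sum_range_succ',
      ← Finset.sum_range_reflect]
    have a1 : ∀ t ∈ Finset.range r,
        (-1 : SymF) ^ (r - 1 - t) * (qSym (r - 1 - t) * qSym (2 * r - (r - 1 - t))) =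
        (-1) ^ r * ((-1 : SymF) ^ (t + 1) * (qSym (r + (t + 1)) * qSym (r - (t + 1)))) := by
      intro t ht
      have := Finset.mem_range.mp ht
      rw [show r - 1 - t = r - (t + 1) by omega, show 2 * r - (r - (t + 1)) = r + (t + 1) by omega]
      have : (-1 : SymF) ^ r = (-1) ^ (r - (t + 1)) * (-1) ^ (t + 1) := by
        rw [← pow_add]; congr 1; omega
      rw [this]
      have : ((-1 : SymF) ^ (t + 1)) * (-1) ^ (t + 1) = 1 := by
        rw [← mul_pow]; simp
      linear_combination (-(-1 : SymF) ^ (r - (t + 1)) * (qSym (r + (t + 1)) * qSym (r - (t + 1)))) * this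
    have a2 : ∀ t ∈ Finset.range r,
        (-1 : SymF) ^ (r + (t + 1)) * (qSym (r + (t + 1)) * qSym (2 * r - (r + (t + 1)))) =
        (-1) ^ r * ((-1 : SymF) ^ (t + 1) * (qSym (r + (t + 1)) * qSym (r - (t + 1)))) := by
      intro t ht
      rw [show 2 * r - (r + (t + 1)) = r - (t + 1) by omega, pow_add]; ring
    rw [Finset.sum_congr rfl a1, Finset.sum_congr rfl a2, ← Finset.mul_sum]
    rw [show 2 * r - (r + 0) = r by omega, add_zero]
    ring
  rw [e] at h
  have h2 := congrArg (fun x => (-1 : SymF) ^ r * x) h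
  simp only [← mul_assoc, ← mul_pow] at h2
  simpa [mul_assoc] using h2

theorem QA2_anti (r s : ℕ) : QA2 r s = - QA2 s r := by
  unfold QA2
  rcases lt_trichotomy r s with h | h | h
  · simp [h, h.not_gt]
  · simp [h]
  · simp [h, h.not_gt]

theorem QC2_anti (r s : ℕ) : QC2 r s = - QC2 s r := by
  unfold QC2
  rcases lt_trichotomy r s with h | h | h
  · simp [h, h.not_gt]
  · simp [h]
  · simp [h, h.not_gt]

theorem QA2_diag (r : ℕ) : QA2 r r = 0 := by simp [QA2]
theorem QC2_diag (r : ℕ) : QC2 r r = 0 := by simp [QC2]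
theorem QA2_r0 (r : ℕ) (h : r ≠ 0) : QA2 r 0 = qSym r := by
  simp [QA2, Nat.pos_of_ne_zero h, QA2core, qSym]
theorem QC2_r0 (r : ℕ) (h : r ≠ 0) : QC2 r 0 = qSym r := by
  simp [QC2, Nat.pos_of_ne_zero h, QC2core, qSym]

theorem QA2_rec (r s : ℕ) : QA2 r (s + 1) + QA2 (r + 1) s =
    qSym r * qSym (s + 1) - qSym (r + 1) * qSym s := by
  have main : ∀ r s, s < r → QA2 r (s + 1) + QA2 (r + 1) s =
      qSym r * qSym (s + 1) - qSym (r + 1) * qSym s := by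
    intro r s h
    have h2 : QA2 (r + 1) s = QA2core (r + 1) s := by simp [QA2]; omega
    have h1 : QA2 r (s + 1) = QA2core r (s + 1) := by
      rcases Nat.lt_or_ge (s + 1) r with h3 | h3
      · simp [QA2, h3]
      · have : r = s + 1 := by omega
        rw [← this, QA2_diag, QA2core_diag _ (by omega)]
    rw [h1, h2, QA2core_rec]
  rcases lt_trichotomy r s with h | h | h
  · have := main s r h
    rw [QA2_anti r (s + 1), QA2_anti (r + 1) s]
    linear_combination -this
  · subst h
    rw [QA2_anti]; ring
  · exact main r s h

theorem QC2core_eq (r s : ℕ) : QC2core r s = qSym r * qSym s +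
    2 * ∑ t ∈ Finset.range s, (-1 : SymF) ^ (t + 1) *
      ((qZ ((r : ℤ) + t + 1) + 2 * (∑ i ∈ Finset.range t, qZ ((r : ℤ) + t - 1 - 2 * i))
          + qZ ((r : ℤ) - t - 1)) * qSym (s - (t + 1))) := by
  rw [QC2core, sum_Icc_one]
  refine congrArg (fun z => qSym r * qSym s + 2 * z) ?_
  refine Finset.sum_congr rfl fun t ht => ?_
  have := Finset.mem_range.mp ht
  rw [qZ_of ((s : ℤ) - _) (s - (t + 1)) (by omega), sum_Icc_one]
  have e1 : (r : ℤ) + (t + 1 : ℕ) = (r : ℤ) + t + 1 := by push_cast; ring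
  have e2 : (r : ℤ) - (t + 1 : ℕ) = (r : ℤ) - t - 1 := by push_cast; ring
  have e3 : ∀ i : ℕ, (r : ℤ) + t + 1 - 2 * (i + 1 : ℕ) = (r : ℤ) + t - 1 - 2 * i := by
    intro i; push_cast; ring
  simp only [e1, e2, e3, Nat.add_sub_cancel]

theorem QC2core_rec (r s : ℕ) : QC2core (r + 1) (s + 1) + QC2core r s =
    QA2core (r + 1) (s + 1) - QA2core r s := by
  rw [QC2core_eq, QC2core_eq, QA2core_eq, QA2core_eq, Finset.sum_range_succ',
    Finset.sum_range_succ']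
  have : ∀ t ∈ Finset.range s,
      (-1 : SymF) ^ (t + 1 + 1) *
      ((qZ (((r + 1 : ℕ) : ℤ) + (t + 1 : ℕ) + 1) + 2 * (∑ i ∈ Finset.range (t + 1),
        qZ (((r + 1 : ℕ) : ℤ) + (t + 1 : ℕ) - 1 - 2 * i))
          + qZ (((r + 1 : ℕ) : ℤ) - (t + 1 : ℕ) - 1)) * qSym (s + 1 - (t + 1 + 1))) =
      (-1 : SymF) ^ (t + 1 + 1) * (qSym (r + 1 + (t + 1 + 1)) * qSym (s + 1 - (t + 1 + 1))) -
      (-1 : SymF) ^ (t + 1) * (qSym (r + (t + 1)) * qSym (s - (t + 1))) -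
      (-1 : SymF) ^ (t + 1) *
      ((qZ ((r : ℤ) + t + 1) + 2 * (∑ i ∈ Finset.range t, qZ ((r : ℤ) + t - 1 - 2 * i))
          + qZ ((r : ℤ) - t - 1)) * qSym (s - (t + 1))) := by
    intro t ht
    rw [Finset.sum_range_succ', show s + 1 - (t + 1 + 1) = s - (t + 1) by omega]
    rw [qZ_of (((r + 1 : ℕ) : ℤ) + (t + 1 : ℕ) + 1) (r + 1 + (t + 1 + 1)) (by push_cast; ring)]
    rw [qZ_of (((r + 1 : ℕ) : ℤ) + (t + 1 : ℕ) - 1 - 2 * (0 : ℕ)) (r + (t + 1)) (by push_cast; ring)]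
    rw [qZ_of ((r : ℤ) + t + 1) (r + (t + 1)) (by push_cast; ring)]
    rw [show ((r + 1 : ℕ) : ℤ) - (t + 1 : ℕ) - 1 = (r : ℤ) - t - 1 by push_cast; ring]
    have : ∀ i : ℕ, ((r + 1 : ℕ) : ℤ) + (t + 1 : ℕ) - 1 - 2 * (i + 1 : ℕ) =
      (r : ℤ) + t - 1 - 2 * i := by intro i; push_cast; ring
    simp only [this]
    ring
  rw [Finset.sum_congr rfl this, Finset.sum_sub_distrib, Finset.sum_sub_distrib]
  rw [qZ_of (((r + 1 : ℕ) : ℤ) + (0 : ℕ) + 1) (r + 1 + (0 + 1)) (by push_cast; ring),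
    qZ_of (((r + 1 : ℕ) : ℤ) - (0 : ℕ) - 1) r (by push_cast; ring)]
  simp
  ring

theorem QC2_rec (r s : ℕ) : QC2 (r + 1) (s + 1) + QC2 r s = QA2 (r + 1) (s + 1) - QA2 r s := by
  have main : ∀ r s, s < r → QC2 (r + 1) (s + 1) + QC2 r s = QA2 (r + 1) (s + 1) - QA2 r s := by
    intro r s h
    simp only [QC2, QA2, add_lt_add_iff_right, h, if_true, QC2core_rec]
  rcases lt_trichotomy r s with h | h | h
  · have := main s r h
    rw [QA2_anti, QA2_anti r s, QC2_anti, QC2_anti r s]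
    linear_combination -this
  · subst h
    simp [QC2_diag, QA2_diag]
  · exact main r s h

end PfX
end

noncomputable section
open MvPolynomial

namespace PfX

section ser
variable {R : Type*} [CommRing R]

/-- double power series -/
abbrev PP (R : Type*) [CommRing R] := PowerSeries (PowerSeries R)

/-- double coefficient -/
def cc (r s : ℕ) (F : PP R) : R := PowerSeries.coeff s (PowerSeries.coeff r F)

/-- first variable -/
def zz : PP R := PowerSeries.X
/-- second variable -/
def ww : PP R := PowerSeries.C PowerSeries.X

theorem cc_ext {F G : PP R} (h : ∀ r s, cc r s F = cc r s G) : F = G :=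
  PowerSeries.ext fun r => PowerSeries.ext fun s => h r s

theorem cc_add (r s : ℕ) (F G : PP R) : cc r s (F + G) = cc r s F + cc r s G := by simp [cc]
theorem cc_sub (r s : ℕ) (F G : PP R) : cc r s (F - G) = cc r s F - cc r s G := by simp [cc]
theorem cc_zero (r s : ℕ) : cc r s (0 : PP R) = 0 := by simp [cc]
theorem cc_z0 (s : ℕ) (F : PP R) : cc 0 s (zz * F) = 0 := by simp [cc, zz]
theorem cc_zs (r s : ℕ) (F : PP R) : cc (r + 1) s (zz * F) = cc r s F := by
  simp [cc, zz, PowerSeries.coeff_succ_X_mul]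
theorem cc_w0 (r : ℕ) (F : PP R) : cc r 0 (ww * F) = 0 := by simp [cc, ww]
theorem cc_ws (r s : ℕ) (F : PP R) : cc r (s + 1) (ww * F) = cc r s F := by
  simp [cc, ww, PowerSeries.coeff_succ_X_mul]

theorem zw_cancel {F G : PP R} (h : (zz + ww) * F = (zz + ww) * G) : F = G := by
  have key : ∀ H : PP R, (zz + ww) * H = 0 → H = 0 := by
    intro H hH
    have h2 : ∀ s r, cc r s H = 0 := by
      intro s
      induction s with
      | zero =>
        intro r
        have := congrArg (cc (r + 1) 0) hH
        simpa [add_mul, cc_add, cc_zs, cc_w0, cc_zero] using this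
      | succ s ih =>
        intro r
        have := congrArg (cc (r + 1) (s + 1)) hH
        simpa [add_mul, cc_add, cc_zs, cc_ws, cc_zero, ih] using this
    exact cc_ext fun r s => by rw [h2, cc_zero]
  have := key (F - G) (by rw [mul_sub, h, sub_self])
  exact sub_eq_zero.mp this

theorem zw1_cancel {F G : PP R} (h : (1 + zz * ww) * F = (1 + zz * ww) * G) : F = G := by
  have key : ∀ H : PP R, (1 + zz * ww) * H = 0 → H = 0 := by
    intro H hH
    rw [add_mul, one_mul, mul_assoc] at hH
    have h2 : ∀ s r, cc r s H = 0 := by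
      intro s
      induction s with
      | zero =>
        intro r
        have := congrArg (cc r 0) hH
        cases r with
        | zero => simpa [cc_add, cc_z0, cc_zero] using this
        | succ r => simpa [cc_add, cc_zs, cc_w0, cc_zero] using this
      | succ s ih =>
        intro r
        have := congrArg (cc r (s + 1)) hH
        cases r with
        | zero => simpa [cc_add, cc_z0, cc_zero] using this
        | succ r => simpa [cc_add, cc_zs, cc_ws, cc_zero, ih] using this
    exact cc_ext fun r s => by rw [h2, cc_zero]
  have := key (F - G) (by rw [mul_sub, h, sub_self])
  exact sub_eq_zero.mp this

theorem cc_one (r s : ℕ) : cc r s (1 : PP R) = if r = 0 ∧ s = 0 then 1 else 0 := by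
  unfold cc
  rw [PowerSeries.coeff_one]
  split_ifs with h1 h2 h2
  · simp [h2.2]
  · rw [PowerSeries.coeff_one, if_neg (fun h => h2 ⟨h1, h⟩)]
  · exact absurd h2.1 h1
  · simp

variable [Algebra ℚ R]

/-- generating function of two-row functions -/
def gen (φ : SymF →ₐ[ℚ] R) (Q2 : ℕ → ℕ → SymF) : PP R :=
  PowerSeries.mk fun r => PowerSeries.mk fun s => φ (Q2 r s)

@[simp] theorem cc_gen (φ : SymF →ₐ[ℚ] R) (Q2 : ℕ → ℕ → SymF) (r s : ℕ) :
    cc r s (gen φ Q2) = φ (Q2 r s) := by simp [cc, gen]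

/-- product of two one-row series -/
def qq (φ : SymF →ₐ[ℚ] R) : PP R :=
  PowerSeries.map PowerSeries.C (qser φ) * PowerSeries.C (qser φ)

theorem qq_cv (φ ψ : SymF →ₐ[ℚ] R) : qq (cv φ ψ) = qq φ * qq ψ := by
  unfold qq
  rw [qser_cv, map_mul, map_mul]
  ring

theorem cc_qq_mul (φ : SymF →ₐ[ℚ] R) (F : PP R) (r s : ℕ) :
    cc r s (qq φ * F) = ∑ a ∈ Finset.range (r + 1), ∑ b ∈ Finset.range (s + 1),
      φ (qSym (r - a)) * φ (qSym (s - b)) * cc a b F := by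
  unfold qq cc
  rw [mul_assoc, mul_comm, PowerSeries.coeff_mul,
    Finset.Nat.sum_antidiagonal_eq_sum_range_succ_mk, map_sum]
  refine Finset.sum_congr rfl fun a _ => ?_
  simp only [PowerSeries.coeff_map, PowerSeries.coeff_C_mul]
  rw [mul_comm, PowerSeries.coeff_C_mul, mul_comm (qser φ), PowerSeries.coeff_mul,
    Finset.Nat.sum_antidiagonal_eq_sum_range_succ_mk, Finset.mul_sum]
  refine Finset.sum_congr rfl fun b _ => ?_
  simp [qser]; ring

theorem cc_qq (φ : SymF →ₐ[ℚ] R) (r s : ℕ) :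
    cc r s (qq φ) = φ (qSym r) * φ (qSym s) := by
  simp [cc, qq, qser]

theorem gen_A (φ : SymF →ₐ[ℚ] R) :
    (zz + ww) * gen φ QA2 = (qq φ - 1) * (zz - ww) := by
  have e : (qq φ - 1) * (zz - ww) = zz * qq φ - ww * qq φ - zz * 1 + ww * 1 := by ring
  rw [e, add_mul]
  refine cc_ext fun r s => ?_
  simp only [cc_add, cc_sub]
  cases r with
  | zero =>
    cases s with
    | zero => simp only [cc_z0, cc_w0]; ring
    | succ s =>
      simp only [cc_z0, cc_ws, cc_gen, cc_qq, cc_one]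
      rcases Nat.eq_zero_or_pos s with h | h
      · simp [h, QA2_diag, qSym]
      · rw [QA2_anti, QA2_r0 _ h.ne']; simp [qSym, h.ne']
  | succ r =>
    cases s with
    | zero =>
      simp only [cc_zs, cc_w0, cc_gen, cc_qq, cc_one]
      rcases Nat.eq_zero_or_pos r with h | h
      · simp [h, QA2_diag, qSym]
      · rw [QA2_r0 _ h.ne']; simp [qSym, h.ne']
    | succ s =>
      simp only [cc_zs, cc_ws, cc_gen, cc_qq, cc_one, ← map_mul, ← map_add, QA2_rec]
      simp

theorem gen_C (φ : SymF →ₐ[ℚ] R) :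
    (1 + zz * ww) * gen φ QC2 = (1 - zz * ww) * gen φ QA2 := by
  rw [add_mul, sub_mul, one_mul, one_mul, mul_assoc, mul_assoc]
  refine cc_ext fun r s => ?_
  simp only [cc_add, cc_sub]
  cases r with
  | zero =>
    simp only [cc_z0, cc_gen]
    rcases Nat.eq_zero_or_pos s with h | h
    · simp [h, QA2_diag, QC2_diag]
    · rw [QA2_anti, QC2_anti, QA2_r0 _ h.ne', QC2_r0 _ h.ne']; simp
  | succ r =>
    cases s with
    | zero => simp [cc_zs, cc_w0, cc_gen, QA2_r0, QC2_r0]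
    | succ s =>
      simp only [cc_zs, cc_ws, cc_gen, ← map_add, QC2_rec, ← map_sub]

/-- the properties of a two-row function needed below -/
structure Good (Q2 : ℕ → ℕ → SymF) : Prop where
  anti : ∀ r s, Q2 r s = - Q2 s r
  diag : ∀ r, Q2 r r = 0
  row : ∀ r, r ≠ 0 → Q2 r 0 = qSym r
  coc : ∀ {R : Type} [CommRing R] [Algebra ℚ R] (φ ψ : SymF →ₐ[ℚ] R) (r s : ℕ),
    cv φ ψ (Q2 r s) = φ (Q2 r s) + ∑ a ∈ Finset.range (r + 1), ∑ b ∈ Finset.range (s + 1),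
      φ (qSym (r - a)) * φ (qSym (s - b)) * ψ (Q2 a b)

theorem coc_of_gen (Q2 : ℕ → ℕ → SymF) (φ ψ : SymF →ₐ[ℚ] R)
    (h : gen (cv φ ψ) Q2 = gen φ Q2 + qq φ * gen ψ Q2) (r s : ℕ) :
    cv φ ψ (Q2 r s) = φ (Q2 r s) + ∑ a ∈ Finset.range (r + 1), ∑ b ∈ Finset.range (s + 1),
      φ (qSym (r - a)) * φ (qSym (s - b)) * ψ (Q2 a b) := by
  have := congrArg (cc r s) h
  simpa [cc_add, cc_qq_mul] using this

theorem gen_cvA (φ ψ : SymF →ₐ[ℚ] R) :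
    gen (cv φ ψ) QA2 = gen φ QA2 + qq φ * gen ψ QA2 := by
  apply zw_cancel
  rw [mul_add, mul_left_comm, gen_A, gen_A, gen_A, qq_cv]
  ring

theorem good_A : Good QA2 where
  anti := QA2_anti
  diag := QA2_diag
  row := QA2_r0
  coc φ ψ := coc_of_gen QA2 φ ψ (gen_cvA φ ψ)

theorem good_C : Good QC2 where
  anti := QC2_anti
  diag := QC2_diag
  row := QC2_r0
  coc φ ψ := coc_of_gen QC2 φ ψ (by
    apply zw1_cancel
    rw [mul_add, mul_left_comm, gen_C, gen_C, gen_C, gen_cvA]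
    ring)

end ser

theorem qSym_cv {R : Type*} [CommRing R] [Algebra ℚ R] (φ ψ : SymF →ₐ[ℚ] R) (r : ℕ) :
    cv φ ψ (qSym r) = ∑ a ∈ Finset.range (r + 1), φ (qSym (r - a)) * ψ (qSym a) := by
  have := congrArg (PowerSeries.coeff r) (qser_cv φ ψ)
  rw [mul_comm, PowerSeries.coeff_mul, Finset.Nat.sum_antidiagonal_eq_sum_range_succ_mk] at this
  simp only [qser, PowerSeries.coeff_mk] at this
  rw [this]
  exact Finset.sum_congr rfl fun _ _ => mul_comm _ _

/-- the trivial specialization -/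
def tr {R : Type*} [CommRing R] [Algebra ℚ R] : SymF →ₐ[ℚ] R := aeval (fun _ => 0)

theorem tr_q {R : Type*} [CommRing R] [Algebra ℚ R] (r : ℕ) :
    (tr : SymF →ₐ[ℚ] R) (qSym r) = if r = 0 then 1 else 0 := by
  cases r with
  | zero => simp [qSym]
  | succ r =>
    rw [qSym, map_smul, map_mul, map_sum, Finset.sum_eq_zero, mul_zero, smul_zero, if_neg (by omega)]
    intro i _
    split_ifs
    · rw [map_mul]; simp [tr]
    · simp

theorem cv_tr {R : Type*} [CommRing R] [Algebra ℚ R] :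
    cv (tr : SymF →ₐ[ℚ] R) tr = tr := by
  apply MvPolynomial.algHom_ext; intro i; simp [cv, tr]

theorem tr_Q2 {R : Type} [CommRing R] [Algebra ℚ R] {Q2 : ℕ → ℕ → SymF} (hQ : Good Q2) (r s : ℕ) :
    (tr : SymF →ₐ[ℚ] R) (Q2 r s) = 0 := by
  have := hQ.coc (tr : SymF →ₐ[ℚ] R) tr r s
  rw [cv_tr, left_eq_add, Finset.sum_eq_single r, Finset.sum_eq_single s] at this
  · simpa [tr_q] using this
  · intro b hb hbs
    have := Finset.mem_range.mp hb
    rw [tr_q (s - b), if_neg (by omega)]; ring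
  · simp
  · intro a ha har
    have := Finset.mem_range.mp ha
    refine Finset.sum_eq_zero fun b _ => ?_
    rw [tr_q (r - a), if_neg (by omega)]; ring
  · simp

end PfX
end

noncomputable section
open MvPolynomial

namespace PfX
open ExteriorAlgebra

section gen
variable {R : Type*} [CommRing R] {V W : Type*} [AddCommGroup V] [Module R V]

theorem cf_congr {B B' : LinearMap.BilinForm R V} (e : B = B') (h : ∀ v, B v v = 0)
    (h' : ∀ v, B' v v = 0) (x : ExteriorAlgebra R V) : cf B h x = cf B' h' x := by
  subst e; rfl

/-- iterated contraction followed by the degree zero part -/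
def DD : List (Module.Dual R V) → ExteriorAlgebra R V →ₗ[R] R
  | [] => eps.toLinearMap
  | d :: L => DD L ∘ₗ ct d

@[simp] theorem DD_nil (x : ExteriorAlgebra R V) : DD [] x = eps x := rfl
@[simp] theorem DD_cons (d : Module.Dual R V) (L) (x : ExteriorAlgebra R V) :
    DD (d :: L) x = DD L (ct d x) := rfl

/-- twisting operator -/
def EE (A : LinearMap.BilinForm R V) (h : ∀ v, A v v = 0) (T : V →ₗ[R] V) :
    ExteriorAlgebra R V →ₗ[R] ExteriorAlgebra R V :=
  (map T).toLinearMap ∘ₗ cf A h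

theorem EE_apply (A : LinearMap.BilinForm R V) (h : ∀ v, A v v = 0) (T : V →ₗ[R] V) (x) :
    EE A h T x = map T (cf A h x) := rfl

theorem ct_EE (A : LinearMap.BilinForm R V) (h : ∀ v, A v v = 0) (T : V →ₗ[R] V)
    (d : Module.Dual R V) (x) : ct d (EE A h T x) = EE A h T (ct (d ∘ₗ T) x) := by
  rw [EE_apply, EE_apply, ct_map, cf_ct]

theorem EE_comp (A A' A'' : LinearMap.BilinForm R V) (h : ∀ v, A v v = 0) (h' : ∀ v, A' v v = 0)
    (h'' : ∀ v, A'' v v = 0) (T T' T'' : V →ₗ[R] V) (hT : T'' = T' ∘ₗ T)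
    (hA : ∀ v w, A'' v w = A v w + A' (T v) (T w)) (x) :
    EE A' h' T' (EE A h T x) = EE A'' h'' T'' x := by
  subst hT
  have hB : ∀ v, (A'.compl₁₂ T T) v v = 0 := fun v => by simp [h']
  have e : A + A'.compl₁₂ T T = A'' := by
    ext v w; simp [hA]
  rw [EE_apply, EE_apply, EE_apply, cf_map T A' h' (A'.compl₁₂ T T) hB (fun _ _ => rfl),
    cf_cf A _ h hB (fun v => by simp [h, h']), cf_congr e _ h'']
  exact (DFunLike.congr_fun (map_comp_map (R := R) T T') _)

/-- the form on the doubled space -/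
def Om (A : LinearMap.BilinForm R V) (T : V →ₗ[R] V) :
    LinearMap.BilinForm R (V × Module.Dual R V) :=
  LinearMap.mk₂ R (fun p p' => A p.1 p'.1 + p'.2 (T p.1) - p.2 (T p'.1))
    (by intros; simp; ring) (by intros; simp; ring) (by intros; simp; ring)
    (by intros; simp; ring)

theorem Om_apply (A : LinearMap.BilinForm R V) (T : V →ₗ[R] V) (p p') :
    Om A T p p' = A p.1 p'.1 + p'.2 (T p.1) - p.2 (T p'.1) := rfl

theorem Om_alt (A : LinearMap.BilinForm R V) (h : ∀ v, A v v = 0) (T : V →ₗ[R] V) (p) :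
    Om A T p p = 0 := by simp [Om_apply, h]

theorem Om_G (A : LinearMap.BilinForm R V) (h : ∀ v, A v v = 0) (T : V →ₗ[R] V)
    (J : List (Module.Dual R V)) (y : ExteriorAlgebra R V) :
    eps (cf (Om A T) (Om_alt A h T) (pr (J.reverse.map (LinearMap.inr R V (Module.Dual R V))) *
      ExteriorAlgebra.map (LinearMap.inl R V (Module.Dual R V)) y)) =
    (-1) ^ J.length * DD J (EE A h T y) := by
  induction J generalizing y with
  | nil =>
    rw [List.reverse_nil, List.map_nil, pr_nil, one_mul,
      cf_map _ _ _ A h (by intro v w; simp [Om_apply]), eps_map, DD_nil, EE_apply, eps_map]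
    simp
  | cons d J ih =>
    have c1 : ∀ x, eps (cf (Om A T) (Om_alt A h T)
        (ι R (LinearMap.inr R V (Module.Dual R V) d) * x)) =
        eps (cf (Om A T) (Om_alt A h T) (ct (Om A T (LinearMap.inr R V (Module.Dual R V) d)) x)) := by
      intro x
      rw [cf_ι_mul, map_add, eps_ι_mul, zero_add, cf_ct]
    rw [List.reverse_cons, List.map_append, pr_append]
    have c2 := ι_mul_pr (R := R) (LinearMap.inr R V (Module.Dual R V) d)
      (J.reverse.map (LinearMap.inr R V (Module.Dual R V)))
    have c3 : pr (J.reverse.map (LinearMap.inr R V (Module.Dual R V))) *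
        pr (List.map (LinearMap.inr R V (Module.Dual R V)) [d]) =
        (-1 : R) ^ J.length • (ι R (LinearMap.inr R V (Module.Dual R V) d) *
          pr (J.reverse.map (LinearMap.inr R V (Module.Dual R V)))) := by
      rw [c2, smul_smul]
      simp [← mul_pow]
    rw [c3, smul_mul_assoc, map_smul, map_smul, mul_assoc, c1, ct_pr_mul]
    rw [Finset.sum_eq_zero, zero_add]
    · have c4 : Om A T (LinearMap.inr R V (Module.Dual R V) d) ∘ₗ
          LinearMap.inl R V (Module.Dual R V) = -(d ∘ₗ T) := by
        ext v; simp [Om_apply]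
      rw [ct_map, c4, ct_neg, map_neg, mul_neg, map_smul, map_smul, map_neg, map_neg, ih,
        smul_smul, DD_cons, ct_EE]
      simp [← mul_pow, pow_succ]
    · intro k _
      simp only [Fin.getElem_fin, List.getElem_map]
      simp [Om_apply]

theorem gP_DD (A : LinearMap.BilinForm R V) (h : ∀ v, A v v = 0) (T : V →ₗ[R] V)
    (I : List V) (J : List (Module.Dual R V)) (hIJ : Even (I.length + J.length)) :
    gP (Om A T) (Om_alt A h T) (I.map (LinearMap.inl R V (Module.Dual R V)) ++
      J.reverse.map (LinearMap.inr R V (Module.Dual R V))) = DD J (EE A h T (pr I)) := by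
  unfold gP
  rw [pr_append, pr_mul_pr, map_smul, map_smul, ← map_pr (LinearMap.inl R V (Module.Dual R V)) I, Om_G, smul_eq_mul, ← mul_assoc, ← pow_add]
  rw [Even.neg_one_pow, one_mul]
  simp only [List.length_map, List.length_reverse]
  have : I.length * J.length + J.length = (I.length + 1) * J.length := by ring
  rw [this, Nat.even_mul]
  rw [Nat.even_add] at hIJ
  rw [Nat.even_add_one]
  tauto

end gen

theorem Pf_map {R : Type*} [CommRing R] [Algebra ℚ R] (φ : SymF →ₐ[ℚ] R) {N : ℕ}
    (B : Matrix (Fin N) (Fin N) SymF) : φ (Pf B) = Pf (B.map φ) := by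
  unfold Pf
  rw [map_smul, map_sum]
  congr 1
  refine Finset.sum_congr rfl fun σ _ => ?_
  rw [map_zsmul, map_prod]
  rfl

section fs
variable {R : Type} [CommRing R] [Algebra ℚ R]

variable (R) in
/-- the basic module -/
abbrev FV := ℕ →₀ R

variable (R) in
/-- basis vectors -/
def be (i : ℕ) : FV R := Finsupp.single i 1

variable (R) in
/-- coordinate functionals -/
def bd (i : ℕ) : Module.Dual R (FV R) := Finsupp.lapply i

theorem bd_be (i j : ℕ) : bd R i (be R j) = if j = i then 1 else 0 := by
  simp [bd, be, Finsupp.single_apply]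

/-- the alternating form -/
def AA (Q2 : ℕ → ℕ → SymF) (φ : SymF →ₐ[ℚ] R) : LinearMap.BilinForm R (FV R) :=
  Finsupp.linearCombination R (fun i => Finsupp.linearCombination R (fun j => φ (Q2 i j)))

theorem AA_be (Q2 : ℕ → ℕ → SymF) (φ : SymF →ₐ[ℚ] R) (i j : ℕ) :
    AA Q2 φ (be R i) (be R j) = φ (Q2 i j) := by
  simp [AA, be]

theorem AA_alt {Q2 : ℕ → ℕ → SymF} (hQ : Good Q2) (φ : SymF →ₐ[ℚ] R) (v : FV R) :
    AA Q2 φ v v = 0 := by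
  have h : AA Q2 φ = - (AA Q2 φ).flip := by
    refine Finsupp.lhom_ext' fun i => LinearMap.ext_ring (Finsupp.lhom_ext' fun j => LinearMap.ext_ring ?_)
    change AA Q2 φ (be R i) (be R j) = - (AA Q2 φ (be R j) (be R i))
    rw [AA_be, AA_be, hQ.anti, map_neg]
  have h2 : AA Q2 φ v v = - AA Q2 φ v v := by
    conv_lhs => rw [h]
    rfl
  have h3 : (2 : ℚ) • AA Q2 φ v v = (2 : ℚ) • (0 : R) := by
    rw [two_smul, smul_zero]; linear_combination h2
  exact smul_right_injective R two_ne_zero h3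

/-- the translation operator -/
def TT (φ : SymF →ₐ[ℚ] R) : FV R →ₗ[R] FV R :=
  Finsupp.linearCombination R
    (fun r => ∑ a ∈ Finset.range (r + 1), φ (qSym (r - a)) • be R a)

theorem TT_be (φ : SymF →ₐ[ℚ] R) (r : ℕ) :
    TT φ (be R r) = ∑ a ∈ Finset.range (r + 1), φ (qSym (r - a)) • be R a := by
  simp [TT, be]

theorem bd_TT (φ : SymF →ₐ[ℚ] R) (r a : ℕ) :
    bd R a (TT φ (be R r)) = φ (qZ ((r : ℤ) - a)) := by
  rw [TT_be, map_sum]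
  simp only [map_smul, bd_be, smul_eq_mul, mul_ite, mul_one, mul_zero, Finset.sum_ite_eq',
    Finset.mem_range]
  split_ifs with h
  · rw [qZ_of _ (r - a) (by omega)]
  · rw [qZ, if_neg (by omega), map_zero]

theorem AA_cv {Q2 : ℕ → ℕ → SymF} (hQ : Good Q2) (φ ψ : SymF →ₐ[ℚ] R) (v w : FV R) :
    AA Q2 (cv φ ψ) v w = AA Q2 φ v w + AA Q2 ψ (TT φ v) (TT φ w) := by
  have h : AA Q2 (cv φ ψ) = AA Q2 φ + (AA Q2 ψ).compl₁₂ (TT φ) (TT φ) := by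
    refine Finsupp.lhom_ext' fun i => LinearMap.ext_ring (Finsupp.lhom_ext' fun j => LinearMap.ext_ring ?_)
    change AA Q2 (cv φ ψ) (be R i) (be R j) = AA Q2 φ (be R i) (be R j) +
      AA Q2 ψ (TT φ (be R i)) (TT φ (be R j))
    rw [AA_be, AA_be, hQ.coc, TT_be, TT_be]
    congr 1
    simp only [map_sum, map_smul, LinearMap.sum_apply, LinearMap.smul_apply, AA_be, smul_eq_mul,
      Finset.mul_sum]
    rw [Finset.sum_comm]
    refine Finset.sum_congr rfl fun a _ => Finset.sum_congr rfl fun b _ => ?_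
    ring
  rw [h]; rfl

theorem fv_ext (v w : FV R) (h : ∀ i, bd R i v = bd R i w) : v = w := Finsupp.ext h

theorem TT_cv (φ ψ : SymF →ₐ[ℚ] R) : TT (cv φ ψ) = TT ψ ∘ₗ TT φ := by
  refine Finsupp.lhom_ext' fun r => LinearMap.ext_ring ?_
  change TT (cv φ ψ) (be R r) = TT ψ (TT φ (be R r))
  refine fv_ext _ _ fun b => ?_
  rw [bd_TT, TT_be φ, map_sum, map_sum]
  simp only [map_smul, bd_TT, smul_eq_mul]
  by_cases hb : b ≤ r
  · rw [qZ_of _ (r - b) (by omega), qSym_cv]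
    conv_rhs => rw [show r + 1 = b + (r - b + 1) by omega, Finset.sum_range_add]
    have z : ∑ x ∈ Finset.range b, φ (qSym (r - x)) * ψ (qZ ((x : ℤ) - b)) = 0 := by
      refine Finset.sum_eq_zero fun a ha => ?_
      have := Finset.mem_range.mp ha
      rw [qZ, if_neg (by omega), map_zero, mul_zero]
    rw [z, zero_add]
    refine Finset.sum_congr rfl fun a _ => ?_
    rw [qZ_of _ a (by push_cast; ring), Nat.sub_sub]
  · rw [qZ, if_neg (by omega), map_zero, Finset.sum_eq_zero]
    intro a ha
    have := Finset.mem_range.mp ha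
    rw [qZ, if_neg (by omega), map_zero, mul_zero]

/-- the basic operator -/
def EQ {Q2 : ℕ → ℕ → SymF} (hQ : Good Q2) (φ : SymF →ₐ[ℚ] R) :
    ExteriorAlgebra R (FV R) →ₗ[R] ExteriorAlgebra R (FV R) :=
  EE (AA Q2 φ) (AA_alt hQ φ) (TT φ)

theorem EQ_cv {Q2 : ℕ → ℕ → SymF} (hQ : Good Q2) (φ ψ : SymF →ₐ[ℚ] R) (x) :
    EQ hQ ψ (EQ hQ φ x) = EQ hQ (cv φ ψ) x :=
  EE_comp _ _ _ _ _ _ _ _ _ (TT_cv φ ψ) (AA_cv hQ φ ψ) x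

theorem EQ_tr {Q2 : ℕ → ℕ → SymF} (hQ : Good Q2) (x : ExteriorAlgebra R (FV R)) :
    EQ hQ tr x = x := by
  have h : AA Q2 (tr : SymF →ₐ[ℚ] R) = 0 := by
    refine Finsupp.lhom_ext' fun i => LinearMap.ext_ring (Finsupp.lhom_ext' fun j => LinearMap.ext_ring ?_)
    change AA Q2 tr (be R i) (be R j) = 0
    rw [AA_be, tr_Q2 hQ]
  have h2 : TT (tr : SymF →ₐ[ℚ] R) = LinearMap.id := by
    refine Finsupp.lhom_ext' fun r => LinearMap.ext_ring ?_
    change TT tr (be R r) = be R r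
    refine fv_ext _ _ fun b => ?_
    rw [bd_TT, bd_be]
    by_cases hb : b ≤ r
    · rw [qZ_of _ (r - b) (by omega), tr_q]
      congr 1
      simp; omega
    · rw [qZ, if_neg (by omega), map_zero, if_neg (by omega)]
  unfold EQ
  rw [EE_apply, cf_congr h _ (by simp), cf_zero, h2]
  simp

/-- wedge of basis vectors -/
def ep (L : List ℕ) : ExteriorAlgebra R (FV R) := pr (L.map (be R))

/-- iterated contraction by coordinate functionals -/
def Dk (L : List ℕ) : ExteriorAlgebra R (FV R) →ₗ[R] R := DD (L.map (bd R))

/-- list of the first `m` parts -/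
def pd (ν : SPartn) (m : ℕ) : List ℕ := (List.range m).map ν.part

@[simp] theorem pd_length (ν : SPartn) (m : ℕ) : (pd ν m).length = m := by simp [pd]

theorem skewQ_eq {Q2 : ℕ → ℕ → SymF} (hQ : Good Q2) (φ : SymF →ₐ[ℚ] R) (lam mu : SPartn) :
    φ (skewQ Q2 lam mu) =
      Dk (pd mu (if Even (lam.len + mu.len) then mu.len else mu.len + 1))
        (EQ hQ φ (ep (pd lam lam.len))) := by
  set m := if Even (lam.len + mu.len) then mu.len else mu.len + 1 with hm
  have hev : Even (lam.len + m) := by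
    rw [hm]; split_ifs with h
    · exact h
    · rw [← add_assoc, Nat.even_add_one]; exact h
  have e0 : skewQ Q2 lam mu = Pf (N := lam.len + m) (Matrix.of fun i j =>
    if _hi : (i : ℕ) < lam.len then
      if _hj : (j : ℕ) < lam.len then Q2 (lam.part i) (lam.part j)
      else qZ ((lam.part i : ℤ) - mu.part (m - 1 - ((j : ℕ) - lam.len)))
    else
      if _hj : (j : ℕ) < lam.len then
        - qZ ((lam.part j : ℤ) - mu.part (m - 1 - ((i : ℕ) - lam.len)))
      else 0) := rfl
  clear_value m
  rw [e0, Pf_map]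
  let v : Fin (lam.len + m) → FV R × Module.Dual R (FV R) := fun i =>
    if (i : ℕ) < lam.len then LinearMap.inl R _ _ (be R (lam.part i)) else
      LinearMap.inr R _ _ (bd R (mu.part (m - 1 - ((i : ℕ) - lam.len))))
  have e1 := Pf_eq_gP (Om (AA Q2 φ) (TT φ)) (Om_alt _ (AA_alt hQ φ) _) hev v
  have e2 := gP_DD (AA Q2 φ) (AA_alt hQ φ) (TT φ) ((pd lam lam.len).map (be R))
    ((pd mu m).map (bd R)) (by simpa using hev)
  have e3 : List.ofFn v = ((pd lam lam.len).map (be R)).map (LinearMap.inl R _ _) ++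
    ((pd mu m).map (bd R)).reverse.map (LinearMap.inr R _ _) := by
    apply List.ext_getElem
    · simp
    · intro i h1 h2
      rw [List.getElem_ofFn, List.getElem_append]
      by_cases hi : i < lam.len
      · simp [v, hi, pd]
      · simp [v, hi, pd, List.getElem_reverse]
  rw [Dk, ep, EQ, ← e2, ← e3, ← e1]
  congr 1
  ext i j
  simp only [Matrix.map_apply, Matrix.of_apply, v, Om_apply]
  by_cases hi : (i : ℕ) < lam.len <;> by_cases hj : (j : ℕ) < lam.len <;>
    simp [hi, hj, AA_be, bd_TT]

end fs

end PfX
end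

noncomputable section
open MvPolynomial

namespace PfX
open ExteriorAlgebra

section gen
variable {R : Type*} [CommRing R] {V : Type*} [AddCommGroup V] [Module R V]

theorem DD_neg (K : List (Module.Dual R V)) (x : ExteriorAlgebra R V) :
    DD K (ExteriorAlgebra.map (-LinearMap.id : V →ₗ[R] V) x) = (-1) ^ K.length * DD K x := by
  induction K generalizing x with
  | nil => simp [eps_map]
  | cons d K ih =>
    have : d ∘ₗ (-LinearMap.id : V →ₗ[R] V) = -d := by ext v; simp
    rw [DD_cons, ct_map, this, ct_neg, map_neg, map_neg, ih, DD_cons, List.length_cons, pow_succ]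
    ring

theorem pr_neg (I : List V) :
    ExteriorAlgebra.map (-LinearMap.id : V →ₗ[R] V) (pr I) = (-1 : R) ^ I.length • pr I := by
  induction I with
  | nil => simp
  | cons a I ih =>
    rw [pr_cons, map_mul, ih, List.length_cons, pow_succ]
    simp

theorem EE_neg (A : LinearMap.BilinForm R V) (h : ∀ v, A v v = 0) (T : V →ₗ[R] V) (x) :
    EE A h T (ExteriorAlgebra.map (-LinearMap.id : V →ₗ[R] V) x) =
      ExteriorAlgebra.map (-LinearMap.id : V →ₗ[R] V) (EE A h T x) := by
  rw [EE_apply, EE_apply, cf_map _ A h A h (by intro v w; simp)]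
  have c := fun (f g : V →ₗ[R] V) z => (DFunLike.congr_fun (map_comp_map (R := R) f g) z)
  simp only [AlgHom.comp_apply] at c
  rw [c, c]
  congr 2
  ext v; simp

theorem DD_parity [Algebra ℚ R] (A : LinearMap.BilinForm R V) (h : ∀ v, A v v = 0) (T : V →ₗ[R] V)
    (I : List V) (K : List (Module.Dual R V)) (hp : ¬ Even (I.length + K.length)) :
    DD K (EE A h T (pr I)) = 0 := by
  have h1 : DD K (EE A h T (ExteriorAlgebra.map (-LinearMap.id : V →ₗ[R] V) (pr I))) =
      (-1) ^ K.length * DD K (EE A h T (pr I)) := by rw [EE_neg, DD_neg]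
  rw [pr_neg, map_smul, map_smul, smul_eq_mul] at h1
  rw [Nat.not_even_iff_odd] at hp
  set z := DD K (EE A h T (pr I))
  have h2 : z = - z := by
    have e := hp.neg_one_pow (α := R)
    rw [pow_add] at e
    have e2 : ((-1 : R) ^ K.length) * (-1) ^ K.length = 1 := by simp [← mul_pow]
    linear_combination (-(-1 : R) ^ K.length) * h1 + z * e - z * e2
  have h3 : (2 : ℚ) • z = (2 : ℚ) • (0 : R) := by
    rw [two_smul, smul_zero]; linear_combination h2
  exact smul_right_injective R two_ne_zero h3

theorem DD_map (K : List (Module.Dual R V)) (T : V →ₗ[R] V) (x) :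
    DD K (ExteriorAlgebra.map T x) = DD (K.map (fun d => d ∘ₗ T)) x := by
  induction K generalizing x with
  | nil => simp [eps_map]
  | cons d K ih => simp only [DD_cons, List.map_cons, ct_map, ih]

theorem DD_kill (A : LinearMap.BilinForm R V) (h : ∀ v, A v v = 0)
    (D K : List (Module.Dual R V)) (L : List V) (y : ExteriorAlgebra R V)
    (hy : ∀ d ∈ D, ct d y = 0) (hL : L.length < D.length) :
    DD (D ++ K) (cf A h (pr L * y)) = 0 := by
  induction D generalizing L with
  | nil => simp at hL
  | cons d D ih =>
    rw [List.cons_append, DD_cons, ← cf_ct, ct_pr_mul, hy d (by simp)]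
    simp only [mul_zero, smul_zero, add_zero, map_sum, map_smul]
    refine Finset.sum_eq_zero fun k _ => ?_
    rw [ih _ (fun d hd => hy d (by simp [hd]))]
    · simp
    · rw [List.length_eraseIdx_of_lt k.2]
      have := k.2
      simp at hL; omega

theorem ct_pr_zero (d : Module.Dual R V) (L : List V) (h : ∀ v ∈ L, d v = 0) :
    ct d (pr L : ExteriorAlgebra R V) = 0 := by
  induction L with
  | nil => simp [ct_one]
  | cons a L ih =>
    rw [pr_cons, ct_ι_mul, h a (by simp), ih (fun v hv => h v (by simp [hv]))]
    simp

theorem DD_ι (K : List (Module.Dual R V)) (v : V) (h : ∀ d ∈ K, d v = 0) (x) :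
    DD K (ι R v * x) = 0 := by
  induction K generalizing x with
  | nil => simp [eps_ι_mul, -map_mul]
  | cons d K ih =>
    rw [DD_cons, ct_ι_mul, h d (by simp), zero_smul, zero_sub, map_neg,
      ih (fun d hd => h d (by simp [hd])), neg_zero]

theorem DD_snoc (K : List (Module.Dual R V)) (d : Module.Dual R V) (x) :
    DD (K ++ [d]) x = (-1) ^ K.length * DD K (ct d x) := by
  induction K generalizing x with
  | nil => simp
  | cons d' K ih =>
    rw [List.cons_append, DD_cons, ih, DD_cons, ct_comm, map_neg, List.length_cons, pow_succ]
    ring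

end gen

section fs
variable {R : Type} [CommRing R] [Algebra ℚ R]

/-- strictly decreasing lists -/
def Dec (L : List ℕ) : Prop := L.Pairwise (fun a b => b < a)

theorem ct_ep_zero (j : ℕ) (I : List ℕ) (h : j ∉ I) : ct (bd R j) (ep I) = 0 := by
  apply ct_pr_zero
  intro v hv
  obtain ⟨i, hi, rfl⟩ := List.mem_map.mp hv
  rw [bd_be, if_neg]
  rintro rfl; exact h hi

theorem Dk_ι (i : ℕ) (J : List ℕ) (h : i ∉ J) (x) : Dk J (ι R (be R i) * x) = 0 := by
  apply DD_ι
  intro d hd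
  obtain ⟨j, hj, rfl⟩ := List.mem_map.mp hd
  rw [bd_be, if_neg]
  rintro rfl; exact h hj

theorem ep_cons (i : ℕ) (I : List ℕ) : (ep (i :: I) : ExteriorAlgebra R (FV R)) =
    ι R (be R i) * ep I := by simp [ep]

theorem Dk_cons (i : ℕ) (I : List ℕ) (x : ExteriorAlgebra R (FV R)) :
    Dk (i :: I) x = Dk I (ct (bd R i) x) := rfl

theorem Dk_ep (I J : List ℕ) (hI : Dec I) (hJ : Dec J) :
    Dk J (ep I : ExteriorAlgebra R (FV R)) = if I = J then 1 else 0 := by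
  induction J generalizing I with
  | nil =>
    cases I with
    | nil => simp [Dk, ep]
    | cons i I => rw [ep_cons]; simp [Dk, eps_ι_mul, -map_mul]
  | cons j J ih =>
    cases I with
    | nil => simp [Dk_cons, ep, ct_one]
    | cons i I =>
      have hI' := List.pairwise_cons.mp hI
      have hJ' := List.pairwise_cons.mp hJ
      rcases lt_trichotomy i j with h | h | h
      · rw [Dk_cons, ct_ep_zero, map_zero, if_neg (by simp; omega)]
        intro hm
        rcases List.mem_cons.mp hm with h2 | h2
        · omega
        · have := hI'.1 j h2; omega
      · subst h
        rw [Dk_cons, ep_cons, ct_ι_mul, bd_be, if_pos rfl, ct_ep_zero, one_smul, mul_zero, sub_zero,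
          ih I hI'.2 hJ'.2]
        · simp
        · intro hm; have := hI'.1 i hm; omega
      · rw [ep_cons, Dk_ι, if_neg (by simp; omega)]
        intro hm
        rcases List.mem_cons.mp hm with h2 | h2
        · omega
        · have := hJ'.1 i h2; omega

theorem ep_straight (i : ℕ) (L : List ℕ) (hL : Dec L) :
    ∃ (c : R) (L' : List ℕ), Dec L' ∧ (∀ a ∈ L', a ∈ i :: L) ∧
      ι R (be R i) * ep L = c • ep L' := by
  induction L with
  | nil => exact ⟨1, [i], by simp [Dec], by simp, by simp [ep]⟩
  | cons j L ih =>
    have hL' := List.pairwise_cons.mp hL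
    rcases lt_trichotomy i j with h | h | h
    · obtain ⟨c, L', h1, h2, h3⟩ := ih hL'.2
      refine ⟨-c, j :: L', ?_, ?_, ?_⟩
      · refine List.pairwise_cons.mpr ⟨fun a ha => ?_, h1⟩
        rcases List.mem_cons.mp (h2 a ha) with h4 | h4
        · omega
        · exact hL'.1 a h4
      · intro a ha
        rcases List.mem_cons.mp ha with h4 | h4
        · simp [h4]
        · have := h2 a h4; simp at this ⊢; tauto
      · rw [ep_cons, ι_swap_mul, h3, ep_cons]; simp
    · subst h
      refine ⟨0, [], by simp [Dec], by simp, ?_⟩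
      rw [ep_cons, ← mul_assoc, ι_sq_zero]; simp
    · refine ⟨1, i :: j :: L, ?_, fun a ha => ha, by rw [one_smul, ep_cons i]⟩
      refine List.pairwise_cons.mpr ⟨fun a ha => ?_, hL⟩
      rcases List.mem_cons.mp ha with h4 | h4
      · omega
      · have := hL'.1 a h4; omega

theorem mem_span (x : ExteriorAlgebra R (FV R)) :
    x ∈ Submodule.span R (Set.range fun J : {J : List ℕ // Dec J} =>
      (ep J.1 : ExteriorAlgebra R (FV R))) := by
  induction x using ext_ind with
  | h0 r =>
    rw [Algebra.algebraMap_eq_smul_one]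
    exact Submodule.smul_mem _ _ (Submodule.subset_span ⟨⟨[], by simp [Dec]⟩, by simp [ep]⟩)
  | hadd x y hx hy => exact Submodule.add_mem _ hx hy
  | hmul x v hx =>
    induction hx using Submodule.span_induction with
    | mem x hx =>
      obtain ⟨⟨L, hL⟩, rfl⟩ := hx
      induction v using Finsupp.induction_linear with
      | zero => simp
      | add v w hv hw => rw [map_add, add_mul]; exact Submodule.add_mem _ hv hw
      | single i r =>
        have e : (Finsupp.single i r : FV R) = r • be R i := by simp [be]
        obtain ⟨c, L', h1, _, h3⟩ := ep_straight (R := R) i L hL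
        rw [e, map_smul, smul_mul_assoc, h3]
        exact Submodule.smul_mem _ _ (Submodule.smul_mem _ _ (Submodule.subset_span ⟨⟨L', h1⟩, rfl⟩))
    | zero => simp
    | add x y _ _ hx hy => rw [mul_add]; exact Submodule.add_mem _ hx hy
    | smul a x _ hx => rw [mul_smul_comm]; exact Submodule.smul_mem _ _ hx

theorem expand (f : ExteriorAlgebra R (FV R) →ₗ[R] R) (x : ExteriorAlgebra R (FV R)) :
    f x = ∑ᶠ J : {J : List ℕ // Dec J}, Dk J.1 x * f (ep J.1) := by
  obtain ⟨c, hc⟩ := (Finsupp.mem_span_range_iff_exists_finsupp).mp (mem_span x)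
  have hD : ∀ J : {J : List ℕ // Dec J}, Dk J.1 x = c J := by
    intro J
    rw [← hc, Finsupp.sum, map_sum, Finset.sum_eq_single J]
    · simp [Dk_ep _ _ J.2 J.2]
    · intro I _ hIJ
      rw [map_smul, Dk_ep _ _ I.2 J.2, if_neg (fun h => hIJ (Subtype.ext h)), smul_zero]
    · intro h; simp [Finsupp.notMem_support_iff.mp h]
  rw [finsum_eq_sum_of_support_subset (s := c.support)]
  · conv_lhs => rw [← hc]
    rw [Finsupp.sum, map_sum]
    refine Finset.sum_congr rfl fun J _ => ?_
    rw [hD, map_smul, smul_eq_mul]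
  · intro J hJ
    simp only [Function.mem_support, hD] at hJ
    simp only [Finset.mem_coe, Finsupp.mem_support_iff]
    intro h; exact hJ (by rw [h, zero_mul])

variable {Q2 : ℕ → ℕ → SymF} (hQ : Good Q2)

/-- the operator commuting with everything -/
def th (x : ExteriorAlgebra R (FV R)) : ExteriorAlgebra R (FV R) :=
  ι R (be R 0) * x - ct (bd R 0) x

theorem EQ_th (φ : SymF →ₐ[ℚ] R) (x) : EQ hQ φ (th x) = th (EQ hQ φ x) := by
  have hT : TT φ (be R 0) = be R 0 := by rw [TT_be]; simp [qSym]
  have hA : AA Q2 φ (be R 0) = bd R 0 + -(bd R 0 ∘ₗ TT φ) := by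
    refine Finsupp.lhom_ext' fun j => LinearMap.ext_ring ?_
    change AA Q2 φ (be R 0) (be R j) = bd R 0 (be R j) + - bd R 0 (TT φ (be R j))
    rw [AA_be, bd_be, bd_TT, qZ_of _ j (by simp)]
    rcases Nat.eq_zero_or_pos j with h | h
    · subst h; simp [hQ.diag, qSym]
    · rw [hQ.anti, hQ.row _ h.ne', if_neg h.ne']; simp
  unfold th EQ
  rw [ct_EE, map_sub, EE_apply, cf_ι_mul, map_add, map_mul, hA, ct_add, ct_neg, map_add,
    map_apply_ι, hT, EE_apply, EE_apply, EE_apply, cf_ct, cf_ct, map_neg]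
  abel

theorem SPartn_part_zero (ν : SPartn) (i : ℕ) (h : ν.len ≤ i) : ν.part i = 0 := by
  induction i, h using Nat.le_induction with
  | base => exact Nat.find_spec ν.exists_zero
  | succ i _ ih =>
    by_contra h
    have := ν.strict' i h
    omega

theorem SPartn_part_pos (ν : SPartn) (i : ℕ) (h : i < ν.len) : ν.part i ≠ 0 :=
  Nat.find_min ν.exists_zero h

theorem SPartn_ext {ν ν' : SPartn} (h : ∀ i, ν.part i = ν'.part i) : ν = ν' := by
  cases ν; cases ν'
  have := funext h
  simp only at this
  subst this; rfl

/-- padded list -/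
def pl (p : ℕ) (ν : SPartn) : List ℕ := pd ν (if Even (p + ν.len) then ν.len else ν.len + 1)

theorem pd_succ (ν : SPartn) : pd ν (ν.len + 1) = pd ν ν.len ++ [0] := by
  simp [pd, List.range_succ, SPartn_part_zero]

theorem zero_notMem_pd (ν : SPartn) : 0 ∉ pd ν ν.len := by
  intro h
  obtain ⟨i, hi, h2⟩ := List.mem_map.mp h
  exact SPartn_part_pos ν i (List.mem_range.mp hi) h2

theorem Dk_snoc (K : List ℕ) (x : ExteriorAlgebra R (FV R)) :
    Dk (K ++ [0]) x = (-1) ^ K.length * Dk K (ct (bd R 0) x) := by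
  unfold Dk
  rw [List.map_append]
  simpa using DD_snoc (K.map (bd R)) (bd R 0) x

theorem ep_snoc (K : List ℕ) (h : 0 ∉ K) :
    (ep (K ++ [0]) : ExteriorAlgebra R (FV R)) = (-1 : R) ^ K.length • th (ep K) := by
  rw [th, ct_ep_zero 0 K h, sub_zero]
  unfold ep
  rw [List.map_append, pr_append, ι_mul_pr, smul_smul]
  simp [← mul_pow]

theorem pl_length_even (p : ℕ) (ν : SPartn) : Even (p + (pl p ν).length) := by
  unfold pl
  rw [pd_length]
  split_ifs with h
  · exact h
  · rw [← add_assoc, Nat.even_add_one]; exact h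

theorem skewQ_pl (φ : SymF →ₐ[ℚ] R) (ν μ : SPartn) (p : ℕ) :
    φ (skewQ Q2 ν μ) = Dk (pl p μ) (EQ hQ φ (ep (pl p ν))) := by
  rw [skewQ_eq hQ]
  unfold pl
  by_cases h1 : Even (p + ν.len)
  · have e : Even (ν.len + μ.len) ↔ Even (p + μ.len) := by
      rw [Nat.even_add] at h1 ⊢; rw [Nat.even_add]; tauto
    rw [if_pos h1]
    simp only [e]
  · rw [if_neg h1, pd_succ ν, ep_snoc _ (zero_notMem_pd ν), map_smul, map_smul, EQ_th, pd_length]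
    by_cases h2 : Even (p + μ.len)
    · have e : ¬ Even (ν.len + μ.len) := by
        rw [Nat.even_add] at h1 h2 ⊢; tauto
      rw [if_pos h2, if_neg e, pd_succ μ, Dk_snoc, th, map_sub, Dk_ι _ _ (zero_notMem_pd μ), pd_length]
      have o := (Nat.not_even_iff_odd.mp e).neg_one_pow (α := R)
      rw [pow_add] at o
      have o2 : ((-1 : R) ^ ν.len) * (-1) ^ ν.len = 1 := by simp [← mul_pow]
      set z := Dk (pd μ μ.len) (ct (bd R 0) (EQ hQ φ (ep (pd ν ν.len))))
      rw [smul_eq_mul]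
      linear_combination ((-1 : R) ^ ν.len) * o * z - o2 * (-1) ^ μ.len * z
    · have e : Even (ν.len + μ.len) := by
        rw [Nat.even_add] at h1 h2 ⊢; tauto
      rw [if_neg h2, if_pos e, pd_succ μ, Dk_snoc, th, map_sub, ct_ct, ct_ι_mul, bd_be, if_pos rfl,
        one_smul, sub_zero, map_sub, Dk_ι _ _ (zero_notMem_pd μ), pd_length, sub_zero, smul_eq_mul,
        ← mul_assoc, ← pow_add, e.neg_one_pow, one_mul]

theorem pl_dec (p : ℕ) (ν : SPartn) : Dec (pl p ν) := by
  unfold Dec pl pd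
  set m := if Even (p + ν.len) then ν.len else ν.len + 1 with hm
  have hm : m ≤ ν.len + 1 := by rw [hm]; split_ifs <;> omega
  rw [List.pairwise_iff_getElem]
  intro i j hi hj hij
  simp only [List.length_map, List.length_range] at hi hj
  simp only [List.getElem_map, List.getElem_range]
  by_cases h : j < ν.len
  · exact SPartn.part_lt ν hij h
  · rw [SPartn_part_zero ν j (by omega)]
    exact Nat.pos_of_ne_zero (SPartn_part_pos ν i (by omega))

theorem pl_getD (p : ℕ) (ν : SPartn) (i : ℕ) : (pl p ν)[i]?.getD 0 = ν.part i := by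
  unfold pl pd
  set m := if Even (p + ν.len) then ν.len else ν.len + 1 with hm
  have hm : ν.len ≤ m := by rw [hm]; split_ifs <;> omega
  by_cases h : i < m
  · simp [h]
  · simp [h, SPartn_part_zero ν i (by omega)]

theorem pl_inj (p : ℕ) (ν ν' : SPartn) (h : pl p ν = pl p ν') : ν = ν' :=
  SPartn_ext fun i => by rw [← pl_getD p, ← pl_getD p, h]

theorem pl_surj (p : ℕ) (J : List ℕ) (hJ : Dec J) (hp : Even (p + J.length)) :
    ∃ ν, pl p ν = J := by
  have hJ2 := List.pairwise_iff_getElem.mp hJ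
  let ν : SPartn := ⟨fun i => J[i]?.getD 0, by
    intro i hi
    have h : i + 1 < J.length := by
      by_contra h
      exact hi (by simp [Nat.not_lt.mp h])
    have := hJ2 i (i + 1) (by omega) h (by omega)
    simpa [h, show i < J.length by omega] using this, ⟨J.length, by simp⟩⟩
  have hpart : ∀ i, ν.part i = J[i]?.getD 0 := fun i => rfl
  have h1 : ν.len ≤ J.length := Nat.find_le (by simp [hpart])
  have h2 : J.length ≤ ν.len + 1 := by
    by_contra h
    have h3 := hJ2 ν.len (ν.len + 1) (by omega) (by omega) (by omega)
    have h4 := SPartn_part_zero ν ν.len le_rfl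
    rw [hpart] at h4
    simp [show ν.len < J.length by omega] at h4
    omega
  have h3 : (if Even (p + ν.len) then ν.len else ν.len + 1) = J.length := by
    split_ifs with he
    · by_contra hne
      have : J.length = ν.len + 1 := by omega
      rw [this, ← add_assoc, Nat.even_add_one] at hp
      exact hp he
    · by_contra hne
      have : J.length = ν.len := by omega
      rw [this] at hp
      exact he hp
  refine ⟨ν, ?_⟩
  unfold pl
  rw [h3]
  apply List.ext_getElem
  · simp
  · intro i hi hi2
    simp [pd, hpart, hi2]

theorem skewQ_vanish (hQ : Good Q2) (φ : SymF →ₐ[ℚ] R) (lam ν : SPartn) (h : ¬ ν.Sub lam) :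
    φ (skewQ Q2 lam ν) = 0 := by
  unfold SPartn.Sub at h
  push Not at h
  obtain ⟨i, hi⟩ := h
  have hil : i < ν.len := by
    by_contra h
    rw [SPartn_part_zero ν i (by omega)] at hi; omega
  rw [skewQ_eq hQ]
  set m := if Even (lam.len + ν.len) then ν.len else ν.len + 1 with hm
  have hm : ν.len ≤ m := by rw [hm]; split_ifs <;> omega
  unfold Dk EQ ep
  rw [EE_apply, DD_map, ← List.take_append_drop (i + 1) ((pd ν m).map (bd R)),
    ← List.take_append_drop i ((pd lam lam.len).map (be R)), pr_append, List.map_append]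
  apply DD_kill
  · intro d hd
    apply ct_pr_zero
    intro v hv
    rw [List.mem_iff_getElem] at hd hv
    obtain ⟨a, ha, rfl⟩ := hd
    obtain ⟨b, hb, rfl⟩ := hv
    simp only [List.length_map, List.length_take, pd_length, List.length_drop] at ha hb
    simp only [List.getElem_map, List.getElem_take, List.getElem_drop, pd, List.getElem_range,
      LinearMap.comp_apply]
    rw [bd_TT]
    have h1 : ν.part i ≤ ν.part a := by
      rcases Nat.lt_or_ge a i with h | h
      · exact (SPartn.part_lt ν h hil).le
      · rw [show a = i by omega]
    have h2 : lam.part (i + b) ≤ lam.part i := by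
      rcases Nat.eq_zero_or_pos b with h | h
      · simp [h]
      · exact (SPartn.part_lt lam (show i < i + b by omega) (by omega)).le
    rw [qZ, if_neg (by omega), map_zero]
  · simp; omega

theorem branch (hQ : Good Q2) (φ ψ : SymF →ₐ[ℚ] R) (lam μ : SPartn) :
    cv φ ψ (skewQ Q2 lam μ) = ∑ᶠ ν : SPartn, φ (skewQ Q2 lam ν) * ψ (skewQ Q2 ν μ) := by
  rw [skewQ_pl hQ _ _ _ lam.len, ← EQ_cv]
  rw [show Dk (pl lam.len μ) (EQ hQ ψ (EQ hQ φ (ep (pl lam.len lam)))) =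
    (Dk (pl lam.len μ) ∘ₗ EQ hQ ψ) (EQ hQ φ (ep (pl lam.len lam))) from rfl, expand]
  let g : SPartn → {J : List ℕ // Dec J} := fun ν => ⟨pl lam.len ν, pl_dec _ ν⟩
  have hg : Function.Injective g := fun ν ν' h => pl_inj _ _ _ (congrArg Subtype.val h)
  have e1 : ∀ ν, φ (skewQ Q2 lam ν) * ψ (skewQ Q2 ν μ) =
      Dk (g ν).1 (EQ hQ φ (ep (pl lam.len lam))) *
        (Dk (pl lam.len μ) ∘ₗ EQ hQ ψ) (ep (g ν).1) := by
    intro ν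
    rw [skewQ_pl hQ _ _ _ lam.len, skewQ_pl hQ _ _ _ lam.len]
    rfl
  rw [finsum_congr e1, ← finsum_mem_range (f := fun J : {J : List ℕ // Dec J} =>
    Dk J.1 (EQ hQ φ (ep (pl lam.len lam))) * (Dk (pl lam.len μ) ∘ₗ EQ hQ ψ) (ep J.1)) hg]
  refine finsum_congr fun J => ?_
  classical
  by_cases hJ : J ∈ Set.range g
  · rw [finsum_eq_if, if_pos hJ]
  · rw [finsum_eq_if, if_neg hJ]
    have hp : ¬ Even (lam.len + J.1.length) := by
      intro he
      obtain ⟨ν, hν⟩ := pl_surj lam.len J.1 J.2 he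
      exact hJ ⟨ν, Subtype.ext hν⟩
    have z : Dk J.1 (EQ hQ φ (ep (pl lam.len lam))) = 0 := by
      apply DD_parity
      have := pl_length_even lam.len lam
      simp only [List.length_map]
      rw [Nat.even_add] at this hp ⊢
      tauto
    rw [z, zero_mul]

theorem skewQ_tr (hQ : Good Q2) (lam μ : SPartn) [Decidable (lam = μ)] :
    (tr : SymF →ₐ[ℚ] R) (skewQ Q2 lam μ) = if lam = μ then 1 else 0 := by
  rw [skewQ_pl hQ _ _ _ 0, EQ_tr, Dk_ep _ _ (pl_dec _ _) (pl_dec _ _)]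
  by_cases h : lam = μ
  · simp [h]
  · rw [if_neg h, if_neg (fun h2 => h (pl_inj _ _ _ h2))]

end fs

end PfX
end

noncomputable section
open MvPolynomial
namespace PfX

theorem Sub_refl (lam : SPartn) : lam.Sub lam := fun _ => le_rfl
theorem Sub_trans {a b c : SPartn} (h : a.Sub b) (h2 : b.Sub c) : a.Sub c :=
  fun i => (h i).trans (h2 i)

theorem finite_sub (lam : SPartn) : {ν : SPartn | ν.Sub lam}.Finite := by
  let f : SPartn → (Fin lam.len → ℕ) := fun ν i => ν.part i
  refine Set.Finite.of_finite_image (f := f) ?_ ?_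
  · refine (Set.finite_Iic (fun i : Fin lam.len => lam.part i)).subset ?_
    rintro _ ⟨ν, hν, rfl⟩
    exact fun i => hν i
  · intro ν hν ρ hρ h
    apply SPartn_ext
    intro i
    by_cases hi : i < lam.len
    · exact congrFun h ⟨i, hi⟩
    · have h1 := hν i
      have h2 := hρ i
      rw [SPartn_part_zero lam i (by omega)] at h1 h2
      omega

def Dn (lam : SPartn) : Finset SPartn := (finite_sub lam).toFinset

theorem mem_Dn (lam ν : SPartn) : ν ∈ Dn lam ↔ ν.Sub lam := by simp [Dn]

section W
variable {R : Type} [CommRing R]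

open scoped Classical in
/-- iterated kernel product -/
def Wk (K : ℕ → SPartn → SPartn → R) : ℕ → SPartn → SPartn → R
  | 0, lam, μ => if lam = μ then 1 else 0
  | m + 1, lam, μ => ∑ ν ∈ Dn lam, K m lam ν * Wk K m ν μ

theorem Wk_congr (K K2 : ℕ → SPartn → SPartn → R) (m : ℕ)
    (h : ∀ i < m, K i = K2 i) (lam μ : SPartn) : Wk K m lam μ = Wk K2 m lam μ := by
  induction m generalizing lam with
  | zero => rfl
  | succ m ih =>
    simp only [Wk]
    rw [h m (by omega)]
    exact Finset.sum_congr rfl fun ν _ => by rw [ih fun i hi => h i (by omega)]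

/-- chains -/
def Ch (n : ℕ) (lam μ : SPartn) : Set (Fin (n + 1) → SPartn) :=
  {c | c 0 = μ ∧ c (Fin.last n) = lam ∧ ∀ i : Fin n, (c i.castSucc).Sub (c i.succ)}

def sn (n : ℕ) (lam : SPartn) (c : Fin (n + 1) → SPartn) : Fin (n + 1 + 1) → SPartn :=
  Fin.snoc (α := fun _ => SPartn) c lam

theorem sn_inj (n : ℕ) (lam : SPartn) : Function.Injective (sn n lam) := by
  intro c d h
  funext i
  have := congrFun h i.castSucc
  simpa [sn] using this

theorem Ch_succ (n : ℕ) (lam μ : SPartn) :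
    Ch (n + 1) lam μ = ⋃ ν ∈ {ν : SPartn | ν.Sub lam}, sn n lam '' Ch n ν μ := by
  ext c
  simp only [Set.mem_iUnion, Set.mem_image, Set.mem_ofPred_eq, exists_prop]
  constructor
  · rintro ⟨h0, hl, hs⟩
    have hh := hs (Fin.last n)
    rw [Fin.succ_last, hl] at hh
    refine ⟨_, hh, fun i => c i.castSucc, ⟨h0, rfl, fun i => ?_⟩, ?_⟩
    · have := hs i.castSucc
      rwa [Fin.succ_castSucc] at this
    · funext i
      refine Fin.lastCases ?_ (fun i => ?_) i
      · simp [sn, hl]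
      · simp [sn]
  · rintro ⟨ν, hν, d, ⟨h0, hl, hs⟩, rfl⟩
    refine ⟨?_, by simp [sn], fun i => ?_⟩
    · rw [← Fin.castSucc_zero]; simp only [sn, Fin.snoc_castSucc]; exact h0
    · refine Fin.lastCases ?_ (fun i => ?_) i
      · rw [Fin.succ_last]; simp only [sn, Fin.snoc_castSucc, Fin.snoc_last]; rwa [hl]
      · rw [Fin.succ_castSucc]; simp only [sn, Fin.snoc_castSucc]; exact hs i

theorem Ch_finite (n : ℕ) (lam μ : SPartn) : (Ch n lam μ).Finite := by
  induction n generalizing lam with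
  | zero =>
    refine (Set.finite_singleton (fun _ => μ)).subset ?_
    rintro c ⟨h, -⟩
    exact funext fun i => by rw [Subsingleton.elim (α := Fin 1) i 0]; exact h
  | succ n ih =>
    rw [Ch_succ]
    exact (finite_sub lam).biUnion fun ν _ => (ih ν).image _

theorem Wk_chain (K : ℕ → SPartn → SPartn → R) (n : ℕ) (lam μ : SPartn) :
    Wk K n lam μ = ∑ᶠ c ∈ Ch n lam μ, ∏ i : Fin n, K i (c i.succ) (c i.castSucc) := by
  induction n generalizing lam with
  | zero =>
    simp only [Wk, Finset.univ_eq_empty, Finset.prod_empty]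
    by_cases h : lam = μ
    · have : Ch 0 lam μ = {fun _ => μ} := by
        ext c
        constructor
        · rintro ⟨h, -⟩
          exact funext fun i => by rw [Subsingleton.elim (α := Fin 1) i 0]; exact h
        · rintro rfl
          exact ⟨rfl, h.symm, fun i => i.elim0⟩
      rw [if_pos h, this, finsum_mem_singleton]
    · have : Ch 0 lam μ = ∅ := by
        ext c
        simp only [Set.mem_empty_iff_false, iff_false]
        rintro ⟨h1, h2, -⟩
        exact h (h2.symm.trans h1)
      rw [if_neg h, this, finsum_mem_empty]
  | succ n ih =>
    rw [Ch_succ, finsum_mem_biUnion ?_ (finite_sub lam) fun ν _ => (Ch_finite n ν μ).image _]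
    · simp only [Wk]
      rw [← Set.Finite.coe_toFinset (finite_sub lam), finsum_mem_coe_finset]
      refine Finset.sum_congr rfl fun ν _ => ?_
      rw [finsum_mem_image (sn_inj n lam).injOn, ih, mul_finsum_mem' _ _ (Ch_finite n ν μ)]
      refine finsum_mem_congr rfl fun c hc => ?_
      rw [Fin.prod_univ_castSucc, mul_comm]
      congr 1
      · refine Finset.prod_congr rfl fun i _ => ?_
        rw [Fin.succ_castSucc]; simp only [sn, Fin.snoc_castSucc]; rfl
      · rw [Fin.succ_last]; simp only [sn, Fin.snoc_castSucc, Fin.snoc_last]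
        rw [hc.2.1]; simp
    · intro ν _ ρ _ hne
      rw [Function.onFun, Set.disjoint_left]
      rintro _ ⟨c, hc, rfl⟩ ⟨d, hd, h⟩
      have := sn_inj n lam h
      subst this
      exact hne (hc.2.1.symm.trans hd.2.1)

end W

section spec
variable {R : Type} [CommRing R] [Algebra ℚ R] {Q2 : ℕ → ℕ → SymF}

theorem branch_fin (hQ : Good Q2) (φ ψ : SymF →ₐ[ℚ] R) (lam μ : SPartn) :
    cv φ ψ (skewQ Q2 lam μ) = ∑ ν ∈ Dn lam, φ (skewQ Q2 lam ν) * ψ (skewQ Q2 ν μ) := by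
  rw [branch hQ]
  apply finsum_eq_sum_of_support_subset
  intro ν hν
  rw [Finset.mem_coe, mem_Dn]
  by_contra h
  exact hν (by simp only; rw [skewQ_vanish hQ φ lam ν h, zero_mul])

def Phi (φ : ℕ → SymF →ₐ[ℚ] R) : ℕ → SymF →ₐ[ℚ] R
  | 0 => tr
  | m + 1 => cv (φ m) (Phi φ m)

theorem Phi_X (φ : ℕ → SymF →ₐ[ℚ] R) (m r : ℕ) :
    Phi φ m (X r) = ∑ i : Fin m, φ i (X r) := by
  induction m with
  | zero => simp [Phi, tr]
  | succ m ih => simp [Phi, cv, ih, Fin.sum_univ_castSucc, add_comm]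

theorem Wk_Phi (hQ : Good Q2) (φ : ℕ → SymF →ₐ[ℚ] R) (m : ℕ) (lam μ : SPartn) :
    Wk (fun i a b => φ i (skewQ Q2 a b)) m lam μ = Phi φ m (skewQ Q2 lam μ) := by
  classical
  induction m generalizing lam with
  | zero => rw [Phi, skewQ_tr hQ]; simp only [Wk]
  | succ m ih => rw [Phi, branch_fin hQ]; simp only [Wk, ih]

theorem Wk_split (hQ : Good Q2) (φ : ℕ → SymF →ₐ[ℚ] R) (K : ℕ → SPartn → SPartn → R)
    (k m : ℕ) (hK : ∀ i a b, K (k + i) a b = φ i (skewQ Q2 a b)) (lam μ : SPartn) :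
    Wk K (k + m) lam μ = ∑ ν ∈ Dn lam, Phi φ m (skewQ Q2 lam ν) * Wk K k ν μ := by
  classical
  induction m generalizing lam with
  | zero =>
    simp only [Phi, skewQ_tr hQ, add_zero, ite_mul, one_mul, zero_mul, Finset.sum_ite_eq]
    rw [if_pos ((mem_Dn _ _).2 (Sub_refl lam))]
  | succ m ih =>
    simp only [Phi, branch_fin hQ, Finset.sum_mul]
    rw [Finset.sum_comm, ← add_assoc]
    simp only [Wk]
    refine Finset.sum_congr rfl fun ρ hρ => ?_
    rw [hK, ih, Finset.mul_sum]
    simp only [mul_assoc]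
    refine Finset.sum_subset (fun ν hν => ?_) (fun ν _ hν => ?_)
    · rw [mem_Dn] at *; exact Sub_trans hν hρ
    · rw [mem_Dn] at hν
      rw [skewQ_vanish hQ _ _ _ hν]; simp

end spec

theorem QA_vanish {R : Type} [CommRing R] [Algebra ℚ R] (φ : SymF →ₐ[ℚ] R) (lam ν : SPartn)
    (h : ¬ ν.Sub lam) : φ (QAskew lam ν) = 0 := skewQ_vanish good_A φ lam ν h

theorem QC_vanish {R : Type} [CommRing R] [Algebra ℚ R] (φ : SymF →ₐ[ℚ] R) (lam ν : SPartn)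
    (h : ¬ ν.Sub lam) : φ (QCskew lam ν) = 0 := skewQ_vanish good_C φ lam ν h

def phC (k n i : ℕ) : SymF →ₐ[ℚ] IRing k (n - k) := if h : i < k then piC1at k n ⟨i, h⟩ else tr
def phA (k n i : ℕ) : SymF →ₐ[ℚ] IRing k (n - k) :=
  if h : i < n - k then piA1at k n ⟨i, h⟩ else tr

theorem Phi_phA (k n : ℕ) : Phi (phA k n) (n - k) = piAupper k n := by
  apply MvPolynomial.algHom_ext
  intro r
  rw [Phi_X]
  simp [phA, piAupper, piA1at]

theorem Phi_phC (k n : ℕ) (x : SymF) : Phi (phC k n) k x = C (piC k x) := by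
  have : Phi (phC k n) k =
      ((Algebra.ofId (Laur k) (IRing k (n - k))).restrictScalars ℚ).comp (piC k) := by
    apply MvPolynomial.algHom_ext
    intro r
    rw [Phi_X]
    simp [phC, piC, piC1at, Algebra.ofId_apply, MvPolynomial.algebraMap_eq]
  rw [this]
  simp [Algebra.ofId_apply, MvPolynomial.algebraMap_eq]

def KK (k n i : ℕ) (a b : SPartn) : IRing k (n - k) :=
  if i < k then phC k n i (QCskew a b) else phA k n (i - k) (QAskew a b)

open scoped Classical in
theorem interQ_eq (k n : ℕ) (hkn : k ≤ n) (lam μ : SPartn) :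
    interQ k n lam μ = Wk (KK k n) n lam μ := by
  have h := Wk_split good_A (phA k n) (KK k n) k (n - k)
    (by intro i a b; simp [KK, QAskew]) lam μ
  rw [show k + (n - k) = n by omega, Phi_phA] at h
  rw [h, interQ, ← finsum_mem_coe_finset]
  refine finsum_congr fun ν => ?_
  rw [finsum_eq_if, finsum_eq_if]
  have e : Wk (KK k n) k ν μ = C (piC k (QCskew ν μ)) := by
    rw [← Phi_phC k n, QCskew, ← Wk_Phi good_C]
    apply Wk_congr
    intro i hi
    funext a b
    simp [KK, hi, QCskew]
  rw [e]
  by_cases h1 : ν.Sub lam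
  · have h3 : ν ∈ (↑(Dn lam) : Set SPartn) := by rw [Finset.mem_coe, mem_Dn]; exact h1
    by_cases h2 : μ.Sub ν
    · rw [if_pos ⟨h2, h1⟩, if_pos h3, mul_comm]; rfl
    · rw [if_neg (fun h : μ.Sub ν ∧ ν.Sub lam => h2 h.1), QC_vanish (piC k) _ _ h2]; simp
  · have h3 : ν ∉ (↑(Dn lam) : Set SPartn) := by rw [Finset.mem_coe, mem_Dn]; exact h1
    rw [if_neg (fun h : μ.Sub ν ∧ ν.Sub lam => h1 h.2), if_neg h3]

theorem prod_split (k n : ℕ) (hkn : k ≤ n) (c : Fin (n + 1) → SPartn) :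
    ∏ i : Fin n, KK k n i (c i.succ) (c i.castSucc) =
    (∏ i : Fin k,
          piC1at k n i (QCskew (c ⟨(i : ℕ) + 1, by have := i.2; omega⟩)
                               (c ⟨(i : ℕ), by have := i.2; omega⟩))) *
        ∏ j : Fin (n - k),
          piA1at k n j (QAskew (c ⟨k + (j : ℕ) + 1, by have := j.2; omega⟩)
                               (c ⟨k + (j : ℕ), by have := j.2; omega⟩)) := by
  have e : k + (n - k) = n := by omega
  rw [← Equiv.prod_comp (finCongr e), Fin.prod_univ_add]
  congr 1
  · refine Finset.prod_congr rfl fun i _ => ?_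
    have hi := i.2
    simp [KK, phC, Fin.succ, Fin.castSucc, Fin.castAdd, Fin.castLE]
  · refine Finset.prod_congr rfl fun i _ => ?_
    simp [KK, phA, Fin.succ, Fin.castSucc, Fin.natAdd, Fin.castAdd, Fin.castLE]

theorem main (k n : ℕ) (hkn : k ≤ n) (lam mu : SPartn) :
    interQ k n lam mu =
      ∑ᶠ (c : Fin (n + 1) → SPartn)
        (_ : c 0 = mu ∧ c (Fin.last n) = lam ∧
              ∀ i : Fin n, (c i.castSucc).Sub (c i.succ)),
        (∏ i : Fin k,
          piC1at k n i (QCskew (c ⟨(i : ℕ) + 1, by have := i.2; omega⟩)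
                               (c ⟨(i : ℕ), by have := i.2; omega⟩))) *
        ∏ j : Fin (n - k),
          piA1at k n j (QAskew (c ⟨k + (j : ℕ) + 1, by have := j.2; omega⟩)
                               (c ⟨k + (j : ℕ), by have := j.2; omega⟩)) := by
  rw [interQ_eq k n hkn, Wk_chain]
  refine finsum_congr fun c => ?_
  rw [prod_split k n hkn]
  rfl

end PfX
end


open scoped Classical in
/-- Branching expansion of the intermediate symplectic `Q`-polynomial over chains
`μ = μ^{(0)} ⊆ μ^{(1)} ⊆ ⋯ ⊆ μ^{(n)} = λ` of strict partitions:
`Q^{(k,n−k)}_{λ/μ} = Σ Π_{i=1}^k Q^C_{μ^{(i)}/μ^{(i−1)}}(x_i) Π_{j=k+1}^n Q^A_{μ^{(j)}/μ^{(j−1)}}(x_j)`. -/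
theorem interQ_chain_expansion (k n : ℕ) (hkn : k ≤ n) (lam mu : SPartn)
    (hsub : mu.Sub lam) (hlen : lam.len ≤ n) :
    interQ k n lam mu =
      ∑ᶠ (c : Fin (n + 1) → SPartn)
        (_ : c 0 = mu ∧ c (Fin.last n) = lam ∧
              ∀ i : Fin n, (c i.castSucc).Sub (c i.succ)),
        (∏ i : Fin k,
          piC1at k n i (QCskew (c ⟨(i : ℕ) + 1, by have := i.2; omega⟩)
                               (c ⟨(i : ℕ), by have := i.2; omega⟩))) *
        ∏ j : Fin (n - k),
          piA1at k n j (QAskew (c ⟨k + (j : ℕ) + 1, by have := j.2; omega⟩)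
                               (c ⟨k + (j : ℕ), by have := j.2; omega⟩)) := by
  exact PfX.main k n hkn lam mu

end
end
end

section
/- Let μ ⊆ λ be strict partitions. If ℓ(λ) − ℓ(μ) > 1, then π_A^(1)(Q^A_{λ/μ}) = 0 in ℚ[x]. If ℓ(λ) − ℓ(μ) ≤ 1, then π_A^(1)(Q^A_{λ/μ}) = det[ π_A^(1)(q_{λ_i−μ_j}) ]_{i,j=1}^{ℓ(λ)} in ℚ[x], where μ is padded with zero parts up to length ℓ(λ) (and q_r := 0 for r < 0, q_0 := 1). -/
open MvPolynomial

noncomputable section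

noncomputable section


/-- `π_A^{(1)} : Λ → ℚ[x]`, `p_r ↦ x^r`. -/
def piA1 : SymF →ₐ[ℚ] Polynomial ℚ :=
  aeval fun r => Polynomial.X ^ (r + 1)

theorem aux_piA1_qSym_succ (r : ℕ) : piA1 (qSym (r + 1)) = 2 * Polynomial.X ^ (r + 1) := by
  induction r using Nat.strong_induction_on with
  | _ r ih =>
    have hterm : ∀ i ∈ Finset.range r,
        piA1 (if Odd (i + 1) then X i * qSym (r - i) else 0) =
          (if Even i then 2 else 0) * Polynomial.X ^ (r + 1) := by
      intro i hi
      have hi' := Finset.mem_range.mp hi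
      by_cases h : Even i
      · have ho : Odd (i + 1) := h.add_one
        rw [if_pos ho, if_pos h, map_mul]
        obtain ⟨d, hd⟩ : ∃ d, r - i = d + 1 := ⟨r - i - 1, by omega⟩
        rw [hd, ih d (by omega)]
        have : r + 1 = (i + 1) + (d + 1) := by omega
        rw [this, pow_add]
        simp only [piA1, aeval_X]
        ring
      · have ho : ¬ Odd (i + 1) := by
          intro h'; apply h; rw [Nat.odd_add_one] at h'; simpa using h'
        rw [if_neg ho, if_neg h]; simp
    have hcount : ∀ n : ℕ, (∑ i ∈ Finset.range n, (if Even i then (2 : Polynomial ℚ) else 0))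
        + (if Even n then 1 else 0) = (n : Polynomial ℚ) + 1 := by
      intro n
      induction n with
      | zero => simp
      | succ n ihn =>
        rw [Finset.sum_range_succ]
        by_cases h : Even n
        · have h1 : ¬ Even (n + 1) := by simpa [Nat.even_add_one] using h
          rw [if_pos h] at ihn ⊢
          rw [if_neg h1]
          push_cast
          linear_combination ihn
        · have h1 : Even (n + 1) := by simpa [Nat.even_add_one] using h
          rw [if_neg h] at ihn ⊢
          rw [if_pos h1]
          push_cast
          linear_combination ihn
    have hlast : piA1 (if Odd (r + 1) then X r * qSym (r - r) else 0) =
        (if Even r then 1 else 0) * Polynomial.X ^ (r + 1) := by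
      by_cases h : Even r
      · have ho : Odd (r + 1) := h.add_one
        rw [if_pos ho, if_pos h, Nat.sub_self, qSym]
        simp [piA1]
      · have ho : ¬ Odd (r + 1) := by
          intro h'; apply h; rw [Nat.odd_add_one] at h'; simpa using h'
        rw [if_neg ho, if_neg h]; simp
    rw [qSym, map_smul, map_mul, map_sum, Finset.sum_range_succ, Finset.sum_congr rfl hterm, hlast,
      ← Finset.sum_mul, ← add_mul, hcount]
    have h0 : ((r : ℚ) + 1) ≠ 0 := by positivity
    have h2 : piA1 2 = 2 := map_ofNat piA1 2
    rw [h2, inv_smul_eq_iff₀ h0, Polynomial.smul_eq_C_mul]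
    simp
    ring

theorem aux_piA1_qSym (r : ℕ) (hr : 0 < r) : piA1 (qSym r) = 2 * Polynomial.X ^ r := by
  obtain ⟨d, rfl⟩ : ∃ d, r = d + 1 := ⟨r - 1, by omega⟩
  exact aux_piA1_qSym_succ d

theorem aux_QA2core (r s : ℕ) (hr : 0 < r) (hs : 0 < s) : piA1 (QA2core r s) = 0 := by
  obtain ⟨d, rfl⟩ : ∃ d, s = d + 1 := ⟨s - 1, by omega⟩
  have hterm : ∀ t ∈ Finset.range d,
      piA1 ((-1 : SymF) ^ (t + 1) *
        (qZ ((r : ℤ) + (t + 1 : ℕ)) * qZ (((d + 1 : ℕ) : ℤ) - (t + 1 : ℕ)))) =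
      (-1) ^ (t + 1) * (4 * Polynomial.X ^ (r + (d + 1))) := by
    intro t ht
    have ht' := Finset.mem_range.mp ht
    have e1 : (r : ℤ) + (t + 1 : ℕ) = ((r + t + 1 : ℕ) : ℤ) := by push_cast; ring
    have e2 : ((d + 1 : ℕ) : ℤ) - (t + 1 : ℕ) = ((d - t : ℕ) : ℤ) := by omega
    rw [e1, e2]
    simp only [qZ, Int.natCast_nonneg, if_true, Int.toNat_natCast, map_mul, map_pow, map_neg,
      map_one]
    rw [aux_piA1_qSym _ (by omega), aux_piA1_qSym _ (by omega)]
    have : r + (d + 1) = (r + t + 1) + (d - t) := by omega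
    rw [this, pow_add]
    ring
  have hlast : piA1 ((-1 : SymF) ^ (d + 1) *
        (qZ ((r : ℤ) + (d + 1 : ℕ)) * qZ (((d + 1 : ℕ) : ℤ) - (d + 1 : ℕ)))) =
      (-1) ^ (d + 1) * (2 * Polynomial.X ^ (r + (d + 1))) := by
    have e1 : (r : ℤ) + (d + 1 : ℕ) = ((r + (d + 1) : ℕ) : ℤ) := by push_cast; ring
    have e2 : ((d + 1 : ℕ) : ℤ) - (d + 1 : ℕ) = ((0 : ℕ) : ℤ) := by simp
    rw [e1, e2]
    simp only [qZ, Int.natCast_nonneg, if_true, Int.toNat_natCast, map_mul, map_pow, map_neg,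
      map_one]
    rw [aux_piA1_qSym _ (by omega), qSym, map_one]
    ring
  have hgeom : ∀ n : ℕ, 2 * ∑ t ∈ Finset.range n, (-1 : Polynomial ℚ) ^ (t + 1) = (-1) ^ n - 1 := by
    intro n
    induction n with
    | zero => simp
    | succ n ihn => rw [Finset.sum_range_succ, mul_add, ihn]; ring
  have h2 : piA1 2 = 2 := map_ofNat piA1 2
  have hI : Finset.Icc 1 (d + 1) = Finset.Ico 1 (d + 2) := by ext; simp; omega
  rw [QA2core, hI, Finset.sum_Ico_eq_sum_range]
  simp only [Nat.reduceSubDiff, add_comm 1]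
  rw [map_add, map_mul, map_mul, map_sum, Finset.sum_range_succ, Finset.sum_congr rfl hterm, hlast,
    ← Finset.sum_mul, h2, aux_piA1_qSym _ hr, aux_piA1_qSym _ hs]
  have := hgeom d
  rw [pow_add Polynomial.X r]
  linear_combination (4 * Polynomial.X ^ r * Polynomial.X ^ (d + 1)) * this

theorem aux_QA2 (r s : ℕ) (hr : 0 < r) (hs : 0 < s) : piA1 (QA2 r s) = 0 := by
  unfold QA2
  split_ifs
  · exact aux_QA2core r s hr hs
  · rw [map_neg, aux_QA2core s r hs hr, neg_zero]
  · simp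

section PfAux

variable {R : Type*} [CommRing R] [Algebra ℚ R]

/-- Parity splitting of `Fin (2 * l)`. -/
def auxSplit (l : ℕ) : Fin l ⊕ Fin l ≃ Fin (2 * l) where
  toFun := Sum.elim (fun t => ⟨2 * t.1, by omega⟩) (fun t => ⟨2 * t.1 + 1, by omega⟩)
  invFun i := if i.1 % 2 = 0 then Sum.inl ⟨i.1 / 2, by omega⟩ else Sum.inr ⟨i.1 / 2, by omega⟩
  left_inv := by
    rintro (t | t)
    · simp
    · have h1 : ¬ ((2 * t.1 + 1) % 2 = 0) := by omega
      have h2 : (2 * t.1 + 1) / 2 = t.1 := by omega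
      simp [h1, h2]
  right_inv := by
    intro i
    by_cases h : i.1 % 2 = 0
    · simp only [h, if_true, Sum.elim_inl]; ext; simp; omega
    · simp only [h, if_false, Sum.elim_inr]; ext; simp; omega

/-- Low / reversed high halves of `Fin (2 * l)`. -/
def auxHalf (l : ℕ) : Fin l ⊕ Fin l ≃ Fin (2 * l) where
  toFun := Sum.elim (fun t => ⟨t.1, by omega⟩) (fun t => ⟨2 * l - 1 - t.1, by omega⟩)
  invFun i := if h : i.1 < l then Sum.inl ⟨i.1, h⟩ else Sum.inr ⟨2 * l - 1 - i.1, by omega⟩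
  left_inv := by
    rintro (t | t)
    · simp
    · have : ¬ (2 * l - 1 - t.1 < l) := by omega
      have h2 : 2 * l - 1 - (2 * l - 1 - t.1) = t.1 := by omega
      simp [this, h2]
  right_inv := by
    intro i
    by_cases h : i.1 < l
    · simp [h]
    · simp only [h, dif_neg, not_false_eq_true, Sum.elim_inr]; ext; simp; omega

theorem aux_sign (l : ℕ) :
    Equiv.Perm.sign ((auxSplit l).symm.trans (auxHalf l)) = 1 := by
  have hval : ∀ i : Fin (2 * l), (((auxSplit l).symm.trans (auxHalf l)) i).1 =
      if i.1 % 2 = 0 then i.1 / 2 else 2 * l - 1 - i.1 / 2 := by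
    intro i
    by_cases h : i.1 % 2 = 0
    · simp [auxSplit, auxHalf, h]
    · simp [auxSplit, auxHalf, h]
  rw [Equiv.Perm.sign_eq_prod_prod_Ioi]
  apply Finset.prod_eq_one
  intro i _
  by_cases h : i.1 % 2 = 0
  · apply Finset.prod_eq_one
    intro j hj
    rw [if_pos]
    have hj' : i.1 < j.1 := Fin.lt_def.mp (Finset.mem_Ioi.mp hj)
    rw [Fin.lt_def, hval, hval, if_pos h]
    split_ifs <;> omega
  · rw [Finset.prod_congr rfl (g := fun _ => (-1 : ℤˣ))]
    · rw [Finset.prod_const, Fin.card_Ioi]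
      apply Even.neg_one_pow
      rw [Nat.even_iff]; omega
    · intro j hj
      rw [if_neg]
      have hj' : i.1 < j.1 := Fin.lt_def.mp (Finset.mem_Ioi.mp hj)
      rw [Fin.lt_def, hval, hval, if_neg h]
      split_ifs <;> omega

theorem aux_double {ι : Type*} [Fintype ι] [DecidableEq ι] (V : ι ⊕ ι → ι ⊕ ι → R)
    (S : Finset ι) :
    ∑ τ : Equiv.Perm (ι ⊕ ι), ((Equiv.Perm.sign τ : ℤˣ) : ℤ) •
      ((∏ t ∈ S, (V (τ (Sum.inl t)) (τ (Sum.inr t)) - V (τ (Sum.inr t)) (τ (Sum.inl t)))) *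
        ∏ t ∈ Sᶜ, V (τ (Sum.inl t)) (τ (Sum.inr t))) =
    2 ^ S.card * ∑ τ : Equiv.Perm (ι ⊕ ι), ((Equiv.Perm.sign τ : ℤˣ) : ℤ) •
      ∏ t, V (τ (Sum.inl t)) (τ (Sum.inr t)) := by
  induction S using Finset.induction_on with
  | empty => simp
  | insert a S ha ih =>
    rw [Finset.card_insert_of_notMem ha, pow_succ', mul_assoc, ← ih]
    have hc : Sᶜ = insert a (insert a S)ᶜ := by
      ext x; by_cases hx : x = a
      · subst hx; simp [ha]
      · simp [hx]
    have hac : a ∉ (insert a S)ᶜ := by simp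
    simp only [hc, Finset.prod_insert ha, Finset.prod_insert hac]
    set G : Equiv.Perm (ι ⊕ ι) → R := fun τ =>
      (∏ t ∈ S, (V (τ (Sum.inl t)) (τ (Sum.inr t)) - V (τ (Sum.inr t)) (τ (Sum.inl t)))) *
        ∏ t ∈ (insert a S)ᶜ, V (τ (Sum.inl t)) (τ (Sum.inr t)) with hG
    have hGs : ∀ τ, G (τ * Equiv.swap (Sum.inl a) (Sum.inr a)) = G τ := by
      intro τ
      have key : ∀ t, t ≠ a → (τ * Equiv.swap (Sum.inl a) (Sum.inr a)) (Sum.inl t) = τ (Sum.inl t)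
          ∧ (τ * Equiv.swap (Sum.inl a) (Sum.inr a)) (Sum.inr t) = τ (Sum.inr t) := by
        intro t ht
        constructor
        · rw [Equiv.Perm.mul_apply, Equiv.swap_apply_of_ne_of_ne] <;> simp [ht]
        · rw [Equiv.Perm.mul_apply, Equiv.swap_apply_of_ne_of_ne] <;> simp [ht]
      simp only [hG]
      congr 1
      · refine Finset.prod_congr rfl fun t ht => ?_
        have := key t (by rintro rfl; exact ha ht)
        rw [this.1, this.2]
      · refine Finset.prod_congr rfl fun t ht => ?_
        have := key t (by rintro rfl; exact hac ht)
        rw [this.1, this.2]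
    have hneg : ∑ τ : Equiv.Perm (ι ⊕ ι), ((Equiv.Perm.sign τ : ℤˣ) : ℤ) •
          (V (τ (Sum.inr a)) (τ (Sum.inl a)) * G τ) =
        - ∑ τ : Equiv.Perm (ι ⊕ ι), ((Equiv.Perm.sign τ : ℤˣ) : ℤ) •
          (V (τ (Sum.inl a)) (τ (Sum.inr a)) * G τ) := by
      rw [← Equiv.sum_comp (Equiv.mulRight (Equiv.swap (Sum.inl a : ι ⊕ ι) (Sum.inr a))),
        ← Finset.sum_neg_distrib]
      refine Finset.sum_congr rfl fun τ _ => ?_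
      rw [Equiv.coe_mulRight, hGs, Equiv.Perm.sign_mul, Equiv.Perm.sign_swap (by simp)]
      simp
    calc _ = ∑ τ : Equiv.Perm (ι ⊕ ι), (((Equiv.Perm.sign τ : ℤˣ) : ℤ) •
          (V (τ (Sum.inl a)) (τ (Sum.inr a)) * G τ) - ((Equiv.Perm.sign τ : ℤˣ) : ℤ) •
          (V (τ (Sum.inr a)) (τ (Sum.inl a)) * G τ)) := by
            refine Finset.sum_congr rfl fun τ _ => ?_
            rw [← smul_sub]
            congr 1
            simp only [hG]; ring
      _ = 2 * ∑ τ : Equiv.Perm (ι ⊕ ι), ((Equiv.Perm.sign τ : ℤˣ) : ℤ) •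
          (V (τ (Sum.inl a)) (τ (Sum.inr a)) * G τ) := by
            rw [Finset.sum_sub_distrib, hneg]; ring
      _ = _ := by
            congr 1
            refine Finset.sum_congr rfl fun τ _ => ?_
            congr 1
            simp only [hG]; ring

theorem aux_sum_blocks {ι : Type*} [Fintype ι] [DecidableEq ι] (A : Matrix ι ι R) :
    ∑ τ : Equiv.Perm (ι ⊕ ι), ((Equiv.Perm.sign τ : ℤˣ) : ℤ) •
      ∏ t, (Matrix.fromBlocks 0 A 0 0 : Matrix (ι ⊕ ι) (ι ⊕ ι) R)
        (τ (Sum.inl t)) (τ (Sum.inr t)) =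
    ((Fintype.card ι).factorial : R) * A.det := by
  classical
  have h1 : ∑ τ : Equiv.Perm (ι ⊕ ι), ((Equiv.Perm.sign τ : ℤˣ) : ℤ) •
      ∏ t, (Matrix.fromBlocks 0 A 0 0 : Matrix (ι ⊕ ι) (ι ⊕ ι) R)
        (τ (Sum.inl t)) (τ (Sum.inr t)) =
      ∑ p : Equiv.Perm ι × Equiv.Perm ι,
        ((Equiv.Perm.sign (Equiv.Perm.sumCongrHom ι ι p) : ℤˣ) : ℤ) • ∏ t, A (p.1 t) (p.2 t) := by
    symm
    apply Finset.sum_of_injOn (Equiv.Perm.sumCongrHom ι ι)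
    · exact Equiv.Perm.sumCongrHom_injective.injOn
    · intro _ _; simp
    · intro τ _ hτ
      have hn : ¬ ∀ t, ∃ y, Sum.inl y = τ (Sum.inl t) := by
        intro hall
        apply hτ
        have hm : τ ∈ (Equiv.Perm.sumCongrHom ι ι).range := by
          apply Equiv.Perm.mem_sumCongrHom_range_of_perm_mapsTo_inl
          rintro _ ⟨t, rfl⟩
          obtain ⟨y, hy⟩ := hall t
          exact ⟨y, hy⟩
        obtain ⟨p, hp⟩ := hm
        exact ⟨p, by simp, hp⟩
      obtain ⟨t, ht⟩ := not_forall.mp hn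
      rw [Finset.prod_eq_zero (Finset.mem_univ t), smul_zero]
      rcases hx : τ (Sum.inl t) with y | y
      · exact absurd ⟨y, hx.symm⟩ ht
      · cases τ (Sum.inr t) <;> simp
    · intro p _
      simp
  rw [h1, Fintype.sum_prod_type]
  have h2 : ∀ α : Equiv.Perm ι, ∑ β : Equiv.Perm ι,
      ((Equiv.Perm.sign (Equiv.Perm.sumCongrHom ι ι (α, β)) : ℤˣ) : ℤ) • ∏ t, A (α t) (β t)
      = A.det := by
    intro α
    have h3 : ∑ β : Equiv.Perm ι, ((Equiv.Perm.sign β : ℤˣ) : ℤ) • ∏ t, A (α t) (β t)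
        = ((Equiv.Perm.sign α : ℤˣ) : ℤ) • A.det := by
      have := Matrix.det_permute α A
      rw [← Matrix.det_transpose, Matrix.det_apply] at this
      simp only [Matrix.transpose_apply, Matrix.submatrix_apply, id, Units.smul_def] at this
      rw [this]; simp
    have h4 : ∀ β : Equiv.Perm ι, Equiv.Perm.sign (Equiv.Perm.sumCongrHom ι ι (α, β)) =
        Equiv.Perm.sign α * Equiv.Perm.sign β := fun β => Equiv.Perm.sign_sumCongr α β
    simp only [h4, Units.val_mul, mul_smul]
    rw [← Finset.smul_sum, h3, ← mul_smul, ← Units.val_mul, Int.units_mul_self]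
    simp
  simp only [h2]
  simp [Fintype.card_perm]

theorem aux_prod_attach (n : ℕ) (f : ∀ t : ℕ, t < n → R) :
    ∏ t ∈ (Finset.range n).attach, f t.1 (Finset.mem_range.mp t.2) =
      ∏ t : Fin n, f t.1 t.2 := by
  refine Finset.prod_bij' (fun t _ => ⟨t.1, Finset.mem_range.mp t.2⟩)
    (fun t _ => ⟨t.1, Finset.mem_range.mpr t.2⟩) ?_ ?_ ?_ ?_ ?_ <;> simp

theorem aux_Pf_eq (l : ℕ) (B : Matrix (Fin (2 * l)) (Fin (2 * l)) R) :
    Pf B = (((2 : ℚ) ^ l * l.factorial))⁻¹ • ∑ σ : Equiv.Perm (Fin (2 * l)),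
      ((Equiv.Perm.sign σ : ℤˣ) : ℤ) •
        ∏ t : Fin l, B (σ (auxSplit l (Sum.inl t))) (σ (auxSplit l (Sum.inr t))) := by
  have hl : 2 * l / 2 = l := by omega
  unfold Pf
  congr 1
  · rw [hl]
  · refine Finset.sum_congr rfl fun σ _ => ?_
    congr 1
    rw [aux_prod_attach (2 * l / 2) (fun t ht => B (σ ⟨2 * t, by omega⟩) (σ ⟨2 * t + 1, by omega⟩))]
    rw [← Equiv.prod_comp (finCongr hl.symm)]
    rfl

theorem aux_Pf_zero (k l : ℕ) (hl : l ≤ 2 * k) (hne : l ≠ k)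
    (B : Matrix (Fin (2 * k)) (Fin (2 * k)) R)
    (hB : ∀ i j : Fin (2 * k), (i.1 < l ↔ j.1 < l) → B i j = 0) : Pf B = 0 := by
  rw [aux_Pf_eq, Finset.sum_eq_zero, smul_zero]
  intro σ _
  by_cases h : ∃ t : Fin k, ((σ (auxSplit k (Sum.inl t))).1 < l ↔ (σ (auxSplit k (Sum.inr t))).1 < l)
  · obtain ⟨t, ht⟩ := h
    rw [Finset.prod_eq_zero (Finset.mem_univ t) (hB _ _ ht), smul_zero]
  · exfalso
    push Not at h
    apply hne
    have h1 : ∑ i : Fin (2 * k), (if i.1 < l then 1 else 0) = l := by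
      rw [Fin.sum_univ_eq_sum_range (fun i => if i < l then 1 else 0), ← Finset.sum_filter]
      have : (Finset.range (2 * k)).filter (fun i => i < l) = Finset.range l := by
        ext; simp; omega
      rw [this]; simp
    rw [← Equiv.sum_comp σ, ← Equiv.sum_comp (auxSplit k), Fintype.sum_sum_type,
      ← Finset.sum_add_distrib, Finset.sum_congr rfl (g := fun _ => 1)] at h1
    · simpa using h1.symm
    · intro t _
      have := h t
      split_ifs <;> omega

theorem aux_Pf_det (l : ℕ) (a : ℕ → ℕ → R) (B : Matrix (Fin (2 * l)) (Fin (2 * l)) R)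
    (hB : ∀ i j : Fin (2 * l), B i j =
      if i.1 < l then if j.1 < l then 0 else a i.1 (l - 1 - (j.1 - l))
      else if j.1 < l then - a j.1 (l - 1 - (i.1 - l)) else 0) :
    Pf B = Matrix.det (Matrix.of fun i j : Fin l => a i.1 j.1) := by
  set A : Matrix (Fin l) (Fin l) R := Matrix.of fun i j : Fin l => a i.1 j.1 with hA
  set V : Matrix (Fin l ⊕ Fin l) (Fin l ⊕ Fin l) R := Matrix.fromBlocks 0 A 0 0 with hV
  have hC : ∀ x y, B (auxHalf l x) (auxHalf l y) = V x y - V y x := by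
    have hlow : ∀ t : Fin l, (auxHalf l (Sum.inl t)).1 = t.1 := fun t => rfl
    have hhigh : ∀ t : Fin l, (auxHalf l (Sum.inr t)).1 = 2 * l - 1 - t.1 := fun t => rfl
    have hnl : ∀ t : Fin l, ¬ (2 * l - 1 - t.1 < l) := fun t => by omega
    have hr : ∀ t : Fin l, l - 1 - (2 * l - 1 - t.1 - l) = t.1 := fun t => by omega
    rintro (x | x) (y | y) <;> rw [hB] <;> simp [hlow, hhigh, hnl, hr, hV, hA]
  rw [aux_Pf_eq]
  have hsum : ∑ σ : Equiv.Perm (Fin (2 * l)),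
      ((Equiv.Perm.sign σ : ℤˣ) : ℤ) •
        ∏ t : Fin l, B (σ (auxSplit l (Sum.inl t))) (σ (auxSplit l (Sum.inr t))) =
      ∑ τ : Equiv.Perm (Fin l ⊕ Fin l), ((Equiv.Perm.sign τ : ℤˣ) : ℤ) •
        ∏ t, (V (τ (Sum.inl t)) (τ (Sum.inr t)) - V (τ (Sum.inr t)) (τ (Sum.inl t))) := by
    rw [← Equiv.sum_comp (Equiv.equivCongr (auxSplit l) (auxHalf l))]
    refine Finset.sum_congr rfl fun τ _ => ?_
    have hs : Equiv.Perm.sign (Equiv.equivCongr (auxSplit l) (auxHalf l) τ) =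
        Equiv.Perm.sign τ := by
      have : Equiv.equivCongr (auxSplit l) (auxHalf l) τ =
        (auxSplit l).symm.trans (Equiv.trans τ (auxHalf l)) := rfl
      rw [this, Equiv.Perm.sign_trans_trans, aux_sign, mul_one]
    rw [hs]
    congr 1
    refine Finset.prod_congr rfl fun t _ => ?_
    rw [← hC]
    simp [Equiv.equivCongr]
  have hd := aux_double (fun x y => V x y) (Finset.univ : Finset (Fin l))
  simp only [Finset.compl_univ, Finset.prod_empty, mul_one] at hd
  rw [hsum, hd, hV, aux_sum_blocks]
  have h0 : ((2 : ℚ) ^ l * l.factorial) ≠ 0 := by positivity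
  rw [inv_smul_eq_iff₀ h0, Algebra.smul_def, map_mul, map_pow,
    map_ofNat (algebraMap ℚ R) 2]
  simp [mul_assoc]

end PfAux

theorem aux_map_Pf {N : ℕ} (B : Matrix (Fin N) (Fin N) SymF) :
    piA1 (Pf B) = Pf (B.map piA1) := by
  unfold Pf
  rw [map_smul, map_sum]
  simp only [map_zsmul, map_prod, Matrix.map_apply]

theorem aux_part_pos (s : SPartn) {i : ℕ} (hi : i < s.len) : 0 < s.part i :=
  Nat.pos_of_ne_zero (Nat.find_min s.exists_zero hi)

theorem aux_len_le (lam mu : SPartn) (hsub : mu.Sub lam) : mu.len ≤ lam.len := by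
  apply Nat.find_min'
  have h : lam.part lam.len = 0 := Nat.find_spec lam.exists_zero
  have := hsub lam.len
  omega

/-- The specialised block matrix, for an arbitrary number `m` of columns. -/
theorem aux_block (lam mu : SPartn) (m N : ℕ) (hN : N = lam.len + m)
    (B : Matrix (Fin N) (Fin N) SymF)
    (hB : ∀ i j : Fin N, B i j =
      if _hi : (i : ℕ) < lam.len then
        if _hj : (j : ℕ) < lam.len then QA2 (lam.part i) (lam.part j)
        else qZ ((lam.part i : ℤ) - mu.part (m - 1 - ((j : ℕ) - lam.len)))
      else
        if _hj : (j : ℕ) < lam.len then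
          - qZ ((lam.part j : ℤ) - mu.part (m - 1 - ((i : ℕ) - lam.len)))
        else 0) (hev : Even N) :
    (lam.len ≠ m → piA1 (Pf B) = 0) ∧
    (lam.len = m → piA1 (Pf B) = Matrix.det (Matrix.of fun i j : Fin lam.len =>
          piA1 (qZ ((lam.part i : ℤ) - (mu.part j : ℤ))))) := by
  have hM : ∀ i j : Fin N, B.map piA1 i j =
      if i.1 < lam.len then if j.1 < lam.len then 0 else
        piA1 (qZ ((lam.part i : ℤ) - mu.part (m - 1 - ((j : ℕ) - lam.len))))
      else if j.1 < lam.len then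
        - piA1 (qZ ((lam.part j : ℤ) - mu.part (m - 1 - ((i : ℕ) - lam.len)))) else 0 := by
    intro i j
    rw [Matrix.map_apply, hB]
    split_ifs with h1 h2 h2
    · exact aux_QA2 _ _ (aux_part_pos lam h1) (aux_part_pos lam h2)
    · rfl
    · rw [map_neg]
    · rw [map_zero]
  rw [aux_map_Pf]
  generalize B.map piA1 = D at hM
  constructor
  · intro hne
    obtain ⟨k, hk⟩ := hev
    obtain rfl : N = 2 * k := by omega
    apply aux_Pf_zero k lam.len (by omega) (by omega)
    intro i j hij
    rw [hM]
    split_ifs <;> first | rfl | (exfalso; tauto)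
  · intro he
    obtain rfl : N = 2 * lam.len := by omega
    subst he
    exact aux_Pf_det lam.len (fun i j => piA1 (qZ ((lam.part i : ℤ) - mu.part j))) D hM

/-- One-variable specialization of the skew Schur `Q`-function: it vanishes when
`ℓ(λ) − ℓ(μ) > 1`, and otherwise is given by the determinant
`det[q_{λ_i − μ_j}]_{i,j=1}^{ℓ(λ)}` (with `μ` padded by zero parts). -/
theorem piA1_QAskew (lam mu : SPartn) (hsub : mu.Sub lam) :
    (1 < lam.len - mu.len → piA1 (QAskew lam mu) = 0) ∧
    (lam.len - mu.len ≤ 1 →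
      piA1 (QAskew lam mu) =
        Matrix.det (Matrix.of fun i j : Fin lam.len =>
          piA1 (qZ ((lam.part i : ℤ) - (mu.part j : ℤ))))) := by
  have hle := aux_len_le lam mu hsub
  set m := if Even (lam.len + mu.len) then mu.len else mu.len + 1 with hm
  have hev : Even (lam.len + m) := by
    rw [hm]; split_ifs with h
    · exact h
    · rw [← add_assoc, Nat.even_add_one]; exact h
  have hmcase : m = mu.len ∨ m = mu.len + 1 := by
    rw [hm]; split_ifs <;> simp
  have key := aux_block lam mu m (lam.len + m) rfl _ (fun i j => rfl) hev
  have hev' := Nat.even_iff.mp hev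
  refine ⟨fun h => key.1 (by omega), fun h => key.2 (by omega)⟩

end
end
end

section
/- Let μ ⊆ λ be strict partitions. If ℓ(λ) − ℓ(μ) > 1, then π_C^(1)(Q^C_{λ/μ}) = 0 in ℚ[x^{±1}]. If ℓ(λ) − ℓ(μ) ≤ 1, then π_C^(1)(Q^C_{λ/μ}) = det[ π_C^(1)(q_{λ_i−μ_j}) ]_{i,j=1}^{ℓ(λ)} in ℚ[x^{±1}], where μ is padded with zero parts up to length ℓ(λ) (and q_r := 0 for r < 0, q_0 := 1). -/
open MvPolynomial

noncomputable section

noncomputable section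


/-- `π_C^{(1)} : Λ → ℚ[x^{±1}]`, `p_r ↦ x^r + x^{−r}`. -/
def piC1 : SymF →ₐ[ℚ] LaurentPolynomial ℚ :=
  aeval fun r => LaurentPolynomial.T ((r : ℤ) + 1) + LaurentPolynomial.T (-((r : ℤ) + 1))

local notation "LP" => LaurentPolynomial ℚ
local notation "TT" => (LaurentPolynomial.T : ℤ → LaurentPolynomial ℚ)

def aC (n : ℕ) : LP := piC1 (qSym n)
def yC : LP := TT 1 + TT (-1)
def pC (n : ℕ) : LP := if Odd (n + 1) then TT ((n : ℤ) + 1) + TT (-((n : ℤ) + 1)) else 0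

theorem TT_mul (a b : ℤ) : TT a * TT b = TT (a + b) := (LaurentPolynomial.T_add a b).symm

theorem aC_zero : aC 0 = 1 := by simp [aC, qSym]

theorem aC_succ (n : ℕ) :
    aC (n + 1) * ((n : LP) + 1) = 2 * ∑ i ∈ Finset.range (n + 1), pC i * aC (n - i) := by
  have h : aC (n + 1) = (((n : ℚ) + 1))⁻¹ • (2 * ∑ i ∈ Finset.range (n + 1), pC i * aC (n - i)) := by
    rw [aC, qSym, map_smul, map_mul, map_sum, map_ofNat]
    congr 3
    ext1 i
    simp only [pC, aC]
    split_ifs with h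
    · simp [piC1]
    · simp
  have e : (n : LP) + 1 = algebraMap ℚ LP ((n : ℚ) + 1) := by simp
  rw [h, Algebra.smul_def, e, mul_right_comm, ← map_mul, inv_mul_cancel₀ (by positivity), map_one,
    one_mul]

def AS : PowerSeries LP := PowerSeries.mk aC
def PS : PowerSeries LP := PowerSeries.mk pC
def DS : PowerSeries LP := 1 - PowerSeries.C yC * PowerSeries.X + PowerSeries.X ^ 2
def ES : PowerSeries LP := 1 + PowerSeries.C yC * PowerSeries.X + PowerSeries.X ^ 2

theorem AS_ode : PowerSeries.derivative LP AS = 2 * (PS * AS) := by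
  ext1 n
  rw [PowerSeries.coeff_derivative, ← map_ofNat (PowerSeries.C (R := LP)) 2, PowerSeries.coeff_C_mul,
    PowerSeries.coeff_mul, AS, PS]
  simp only [PowerSeries.coeff_mk]
  rw [aC_succ, Finset.Nat.sum_antidiagonal_eq_sum_range_succ (fun i j => pC i * aC j)]

theorem DE_eq : DS * ES = 1 - PowerSeries.C (TT 2 + TT (-2)) * PowerSeries.X ^ 2
    + PowerSeries.X ^ 4 := by
  have h : TT 2 + TT (-2) = yC ^ 2 - 2 := by
    have e1 : TT 2 = TT 1 * TT 1 := by rw [TT_mul]; norm_num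
    have e2 : TT (-2) = TT (-1) * TT (-1) := by rw [TT_mul]; norm_num
    have e3 : TT 1 * TT (-1) = 1 := by rw [TT_mul]; simp
    rw [yC, e1, e2]; linear_combination (-2) * e3
  rw [h, DS, ES, map_sub, map_pow, map_ofNat]
  ring

theorem PDE : PS * (DS * ES) = PowerSeries.C yC * (1 - PowerSeries.X ^ 2) := by
  have h : PS * (DS * ES) = PS - PowerSeries.C (TT 2 + TT (-2)) * (PS * PowerSeries.X ^ 2)
      + PS * PowerSeries.X ^ 4 := by rw [DE_eq]; ring
  rw [h]
  obtain ⟨c, hc⟩ : ∃ c, c = TT 2 + TT (-2) := ⟨_, rfl⟩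
  rw [← hc]
  ext1 n
  simp only [map_add, map_sub, PowerSeries.coeff_C_mul, PowerSeries.coeff_mul_X_pow', PS,
    PowerSeries.coeff_mk, PowerSeries.coeff_one, PowerSeries.coeff_X_pow]
  match n with
  | 0 => simp [pC, yC]
  | 1 =>
    have : ¬ Odd 2 := by decide
    simp [pC, this]
  | 2 =>
    have : Odd 3 := by decide
    simp [pC, yC, this, hc]
    simp only [mul_add, add_mul, TT_mul]
    norm_num
    ring
  | 3 =>
    have h2 : ¬ Odd 2 := by decide
    have : ¬ Odd 4 := by decide
    simp [pC, this, h2]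
  | k + 4 =>
    have e1 : k + 4 - 2 = k + 2 := by omega
    have e2 : k + 4 - 4 = k := by omega
    rw [if_pos (by omega), if_pos (by omega), if_neg (by omega), if_neg (by omega), e1, e2]
    simp only [pC]
    by_cases hk : Odd (k + 1)
    · rw [if_pos (by grind), if_pos (by grind), if_pos hk, hc]
      push_cast
      simp only [mul_add, add_mul, TT_mul]
      ring_nf
    · rw [if_neg (by grind), if_neg (by grind), if_neg hk]; simp

theorem cDS : PowerSeries.constantCoeff DS = 1 := by simp [DS]
theorem cES : PowerSeries.constantCoeff ES = 1 := by simp [ES]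

theorem ADE : AS * DS = ES := by
  have hE := PowerSeries.mul_invOfUnit ES 1 (by simp [cES])
  set I := PowerSeries.invOfUnit ES 1
  have hc : PowerSeries.constantCoeff I = 1 := by
    have := congrArg PowerSeries.constantCoeff hE
    simpa [cES] using this
  have hD' : PowerSeries.derivative LP DS = - PowerSeries.C yC + 2 * PowerSeries.X := by
    simp [DS, Derivation.leibniz, two_mul, pow_two]
  have hE' : PowerSeries.derivative LP ES = PowerSeries.C yC + 2 * PowerSeries.X := by
    simp [ES, Derivation.leibniz, two_mul, pow_two]
  have hI : PowerSeries.derivative LP I * ES + I * (PowerSeries.C yC + 2 * PowerSeries.X) = 0 := by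
    have := congrArg (PowerSeries.derivative LP) hE
    rw [Derivation.leibniz, hE', Derivation.map_one_eq_zero] at this
    simp only [smul_eq_mul] at this
    linear_combination this
  have h1 : AS * DS * I = 1 := by
    have : IsAddTorsionFree LP := .of_module_rat _
    apply PowerSeries.derivative.ext
    · rw [Derivation.leibniz, Derivation.leibniz, AS_ode, hD', Derivation.map_one_eq_zero]
      simp only [smul_eq_mul]
      have key : PowerSeries.derivative LP I = - I ^ 2 * (PowerSeries.C yC + 2 * PowerSeries.X) := by
        linear_combination I * hI - PowerSeries.derivative LP I * hE
      have key2 : PS * DS = PowerSeries.C yC * (1 - PowerSeries.X ^ 2) * I := by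
        linear_combination I * PDE - PS * DS * hE
      rw [key]
      have : (2 * PowerSeries.C yC * (1 - PowerSeries.X ^ 2) * I + (- PowerSeries.C yC + 2 * PowerSeries.X) - DS * I * (PowerSeries.C yC + 2 * PowerSeries.X)) = 0 := by
        have : (2 * PowerSeries.C yC * (1 - PowerSeries.X ^ 2) + (- PowerSeries.C yC + 2 * PowerSeries.X) * ES - DS * (PowerSeries.C yC + 2 * PowerSeries.X)) = 0 := by
          rw [DS, ES]; ring
        linear_combination I * this - (- PowerSeries.C yC + 2 * PowerSeries.X) * hE
      linear_combination AS * I * this + 2 * AS * I * key2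
    · simp [hc, cDS, AS, aC_zero]
  linear_combination ES * h1 - AS * DS * hE

theorem negC (c : LP) : PowerSeries.evalNegHom (PowerSeries.C c) = PowerSeries.C c := by
  ext1 n
  rw [PowerSeries.evalNegHom, PowerSeries.coeff_rescale, PowerSeries.coeff_C]
  split_ifs with h <;> simp [h]

theorem rescale_DS : PowerSeries.evalNegHom DS = ES := by
  simp [DS, ES, PowerSeries.evalNegHom_X, negC]

theorem rescale_ES : PowerSeries.evalNegHom ES = DS := by
  simp [DS, ES, PowerSeries.evalNegHom_X, negC]
  ring

theorem AA : PowerSeries.evalNegHom AS * AS = 1 := by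
  have h2 := congrArg PowerSeries.evalNegHom ADE
  rw [map_mul, rescale_DS, rescale_ES] at h2
  have hE := PowerSeries.mul_invOfUnit ES 1 (by simp [cES])
  have hD := PowerSeries.mul_invOfUnit DS 1 (by simp [cDS])
  set I := PowerSeries.invOfUnit ES 1
  set J := PowerSeries.invOfUnit DS 1
  have e1 : AS = ES * J := by linear_combination J * ADE - AS * hD
  have e2 : PowerSeries.evalNegHom AS = DS * I := by
    linear_combination I * h2 - PowerSeries.evalNegHom AS * hE
  rw [e2, e1]; linear_combination ES * I * hD + hE

theorem aa_sum (s : ℕ) (hs : 0 < s) :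
    ∑ t ∈ Finset.range (s + 1), (-1) ^ t * (aC t * aC (s - t)) = 0 := by
  have h := congrArg (PowerSeries.coeff s) AA
  rw [PowerSeries.coeff_mul, PowerSeries.coeff_one, if_neg hs.ne'] at h
  simp only [PowerSeries.evalNegHom, PowerSeries.coeff_rescale, AS, PowerSeries.coeff_mk] at h
  rw [Finset.Nat.sum_antidiagonal_eq_sum_range_succ (fun i j => (-1) ^ i * aC i * aC j)] at h
  simpa [mul_assoc] using h

def dC : LP := TT 1 - TT (-1)
def wC (z : ℤ) : LP := TT z - TT (-z)

theorem dC_ne : dC ≠ 0 := by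
  intro h
  have := congrArg (fun f : LP => f.coeff 1) h
  simp [dC] at this

theorem aC_rec (n : ℕ) : aC (n + 2) = yC * aC (n + 1) - aC n + (if n = 0 then 1 else 0) := by
  have h := congrArg (PowerSeries.coeff (n + 2)) ADE
  have e : AS * DS = AS - PowerSeries.C yC * (AS * PowerSeries.X) + AS * PowerSeries.X ^ 2 := by
    rw [DS]; ring
  rw [e, ES] at h
  simp [PowerSeries.coeff_succ_mul_X, PowerSeries.coeff_mul_X_pow, AS, PowerSeries.coeff_X_pow,
    PowerSeries.coeff_one, PowerSeries.coeff_X] at h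
  linear_combination h

theorem aC_one : aC 1 = 2 * yC := by
  have h := congrArg (PowerSeries.coeff 1) ADE
  have e : AS * DS = AS - PowerSeries.C yC * (AS * PowerSeries.X) + AS * PowerSeries.X ^ 2 := by
    rw [DS]; ring
  rw [e, ES] at h
  simp [PowerSeries.coeff_mul_X_pow', AS, PowerSeries.coeff_X_pow,
    PowerSeries.coeff_one, aC_zero] at h
  linear_combination h

theorem w_rec (n : ℤ) : wC (n + 2) = yC * wC (n + 1) - wC n := by
  simp only [wC, yC, mul_sub, add_mul, TT_mul]
  ring_nf

theorem aC_formula : ∀ n : ℕ, dC * aC (n + 1) = 2 * yC * wC ((n : ℤ) + 1)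
  | 0 => by rw [aC_one]; simp only [Nat.cast_zero, zero_add, dC, wC]; ring
  | 1 => by
    rw [aC_rec, aC_one, aC_zero]
    have := w_rec 0
    have h0 : wC 0 = 0 := by simp [wC]
    have h1 : wC 1 = dC := rfl
    simp only [zero_add, h0, h1] at this
    norm_num
    rw [this]; ring
  | n + 2 => by
    rw [aC_rec, if_neg (by omega)]
    have h1 := aC_formula (n + 1)
    have h2 := aC_formula n
    have h3 := w_rec (n + 1)
    push_cast at *
    have e1 : (n : ℤ) + 2 + 1 = n + 1 + 2 := by ring
    rw [e1, h3]
    linear_combination yC * h1 - h2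

theorem piq (z : ℤ) (hz : 0 < z) : dC * piC1 (qZ z) = 2 * yC * wC z := by
  obtain ⟨n, rfl⟩ : ∃ n : ℕ, z = n + 1 := ⟨(z - 1).toNat, by omega⟩
  rw [← aC_formula n, qZ, if_pos hz.le]; rfl

theorem tele (n : ℤ) (t : ℕ) :
    dC * ∑ i ∈ Finset.Icc 1 t, wC (n - 2 * i) =
      TT (n - 1) - TT (n - 1 - 2 * t) + TT (-(n - 1)) - TT (-(n - 1 - 2 * t)) := by
  induction t with
  | zero => simp
  | succ t ih =>
    rw [Finset.sum_Icc_succ_top (by omega), mul_add, ih]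
    simp only [wC, dC, mul_sub, sub_mul, TT_mul]
    push_cast
    ring_nf

theorem bracket (r t : ℕ) (ht : 0 < t) (htr : t < r) :
    2 * piC1 (qZ ((r : ℤ) + t) + 2 * (∑ i ∈ Finset.Icc 1 (t - 1), qZ ((r : ℤ) + t - 2 * i))
          + qZ ((r : ℤ) - t)) = aC r * aC t := by
  apply mul_left_cancel₀ dC_ne
  apply mul_left_cancel₀ dC_ne
  have hr : dC * aC r = 2 * yC * wC r := by
    obtain ⟨k, rfl⟩ : ∃ k, r = k + 1 := ⟨r - 1, by omega⟩
    rw [aC_formula]; push_cast; rfl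
  have ht' : dC * aC t = 2 * yC * wC t := by
    obtain ⟨k, rfl⟩ : ∃ k, t = k + 1 := ⟨t - 1, by omega⟩
    rw [aC_formula]; push_cast; rfl
  have e : dC * piC1 (qZ ((r : ℤ) + t) + 2 * (∑ i ∈ Finset.Icc 1 (t - 1), qZ ((r : ℤ) + t - 2 * i))
          + qZ ((r : ℤ) - t)) = 2 * yC * (wC (r + t) + 2 *
            (∑ i ∈ Finset.Icc 1 (t - 1), wC ((r : ℤ) + t - 2 * i)) + wC (r - t)) := by
    rw [map_add, map_add, map_mul, map_ofNat, map_sum, mul_add, mul_add, piq _ (by omega),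
      piq _ (by omega), mul_left_comm, Finset.mul_sum, Finset.sum_congr rfl (fun i hi => piq _ (by
        have := Finset.mem_Icc.mp hi; omega)), ← Finset.mul_sum]
    ring
  have e2 := tele ((r : ℤ) + t) (t - 1)
  have e3 : dC * (wC (r + t) + 2 * (∑ i ∈ Finset.Icc 1 (t - 1), wC ((r : ℤ) + t - 2 * i))
      + wC (r - t)) = yC * wC r * wC t := by
    rw [mul_add, mul_add, mul_left_comm, e2]
    obtain ⟨k, rfl⟩ : ∃ k, t = k + 1 := ⟨t - 1, by omega⟩
    simp only [wC, dC, yC, mul_sub, sub_mul, mul_add, add_mul, TT_mul]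
    simp only [Nat.add_sub_cancel]
    push_cast
    ring_nf
  linear_combination 2 * dC * e + 4 * yC * e3 - 2 * yC * wC t * hr - dC * aC r * ht'

theorem QC2core_zero (r s : ℕ) (hs : 0 < s) (hr : s < r) : piC1 (QC2core r s) = 0 := by
  have h := aa_sum s hs
  rw [Finset.range_eq_Ico, Finset.sum_eq_sum_Ico_succ_bot (by omega)] at h
  simp only [pow_zero, one_mul, aC_zero, Nat.sub_zero] at h
  rw [QC2core, map_add, map_mul, map_mul, map_sum, map_ofNat, Finset.mul_sum]
  have : ∀ t ∈ Finset.Icc 1 s, 2 * piC1 ((-1 : SymF) ^ t *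
      ((qZ ((r : ℤ) + t) + 2 * (∑ i ∈ Finset.Icc 1 (t - 1), qZ ((r : ℤ) + t - 2 * i))
          + qZ ((r : ℤ) - t)) * qZ ((s : ℤ) - t))) = aC r * ((-1) ^ t * (aC t * aC (s - t))) := by
    intro t ht
    rw [Finset.mem_Icc] at ht
    have hb := bracket r t (by omega) (by omega)
    have hq : piC1 (qZ ((s : ℤ) - t)) = aC (s - t) := by
      rw [qZ, if_pos (by omega), aC]; congr 2; omega
    rw [map_mul, map_mul, hq, map_pow, map_neg, map_one]
    linear_combination (-1) ^ t * aC (s - t) * hb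
  rw [Finset.sum_congr rfl this, ← Finset.mul_sum]
  have e : Finset.Icc 1 s = Finset.Ico (0 + 1) (s + 1) := by ext; simp <;> omega
  rw [e]
  change aC r * aC s + _ = 0
  linear_combination aC r * h

theorem QC2_zero (r s : ℕ) (hs : 0 < s) (hr : 0 < r) : piC1 (QC2 r s) = 0 := by
  rw [QC2]
  split_ifs with h1 h2
  · exact QC2core_zero r s hs h1
  · rw [map_neg, QC2core_zero s r hr h2, neg_zero]
  · simp

section pf
variable {R : Type*} [CommRing R]

/-- upper part of the block matrix -/
def Cup {m : ℕ} (M : Matrix (Fin m) (Fin m) R) : Fin m ⊕ Fin m → Fin m ⊕ Fin m → R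
  | Sum.inl a, Sum.inr b => M a b
  | _, _ => 0

theorem sum_swap {m : ℕ} (M : Matrix (Fin m) (Fin m) R) (S : Finset (Fin m)) :
    ∑ σ : Equiv.Perm (Fin m ⊕ Fin m), ((Equiv.Perm.sign σ : ℤˣ) : ℤ) •
      ∏ t, (Cup M (σ (Sum.inl t)) (σ (Sum.inr t)) - Cup M (σ (Sum.inr t)) (σ (Sum.inl t))) =
    2 ^ S.card * ∑ σ : Equiv.Perm (Fin m ⊕ Fin m), ((Equiv.Perm.sign σ : ℤˣ) : ℤ) •
      ((∏ t ∈ S, Cup M (σ (Sum.inl t)) (σ (Sum.inr t))) *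
      ∏ t ∈ Sᶜ, (Cup M (σ (Sum.inl t)) (σ (Sum.inr t)) - Cup M (σ (Sum.inr t)) (σ (Sum.inl t)))) := by
  classical
  induction S using Finset.induction_on with
  | empty => simp
  | insert a S ha ih =>
    rw [ih, Finset.card_insert_of_notMem ha, pow_succ, mul_assoc]
    congr 1
    have hc : Sᶜ = insert a (insert a S)ᶜ := by
      ext x; by_cases hx : x = a <;> simp [hx, ha]
    have hac : a ∉ (insert a S)ᶜ := by simp
    set K := (insert a S)ᶜ
    set X : Equiv.Perm (Fin m ⊕ Fin m) → R := fun σ => (∏ t ∈ S, Cup M (σ (Sum.inl t)) (σ (Sum.inr t))) *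
      ∏ t ∈ K, (Cup M (σ (Sum.inl t)) (σ (Sum.inr t)) - Cup M (σ (Sum.inr t)) (σ (Sum.inl t))) with hX
    have hl : ∀ σ : Equiv.Perm (Fin m ⊕ Fin m), ((∏ t ∈ S, Cup M (σ (Sum.inl t)) (σ (Sum.inr t))) *
      ∏ t ∈ Sᶜ, (Cup M (σ (Sum.inl t)) (σ (Sum.inr t)) - Cup M (σ (Sum.inr t)) (σ (Sum.inl t)))) =
      X σ * Cup M (σ (Sum.inl a)) (σ (Sum.inr a)) - X σ * Cup M (σ (Sum.inr a)) (σ (Sum.inl a)) := by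
      intro σ
      rw [hc, Finset.prod_insert hac, hX]; ring
    have hr : ∀ σ : Equiv.Perm (Fin m ⊕ Fin m), ((∏ t ∈ insert a S, Cup M (σ (Sum.inl t)) (σ (Sum.inr t))) *
      ∏ t ∈ K, (Cup M (σ (Sum.inl t)) (σ (Sum.inr t)) - Cup M (σ (Sum.inr t)) (σ (Sum.inl t)))) =
      X σ * Cup M (σ (Sum.inl a)) (σ (Sum.inr a)) := by
      intro σ
      rw [Finset.prod_insert ha, hX]; ring
    simp only [hl, hr, smul_sub, Finset.sum_sub_distrib]
    rw [two_mul, sub_eq_add_neg]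
    congr 1
    rw [← Finset.sum_neg_distrib]
    apply Fintype.sum_equiv (Equiv.mulRight (Equiv.swap (Sum.inl a) (Sum.inr a)))
    intro σ
    have hXs : X (σ * Equiv.swap (Sum.inl a) (Sum.inr a)) = X σ := by
      have hne : ∀ t, t ≠ a → (σ * Equiv.swap (Sum.inl a) (Sum.inr a)) (Sum.inl t) = σ (Sum.inl t) ∧
          (σ * Equiv.swap (Sum.inl a) (Sum.inr a)) (Sum.inr t) = σ (Sum.inr t) := by
        intro t ht
        simp only [Equiv.Perm.mul_apply]
        constructor
        · rw [Equiv.swap_apply_of_ne_of_ne] <;> simp [ht]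
        · rw [Equiv.swap_apply_of_ne_of_ne] <;> simp [ht]
      simp only [hX]
      congr 1
      · refine Finset.prod_congr rfl fun t ht => ?_
        obtain ⟨h1, h2⟩ := hne t (by rintro rfl; exact ha ht)
        rw [h1, h2]
      · refine Finset.prod_congr rfl fun t ht => ?_
        obtain ⟨h1, h2⟩ := hne t (by rintro rfl; exact hac ht)
        rw [h1, h2]
    simp only [Equiv.coe_mulRight]
    rw [hXs, Equiv.Perm.sign_mul, Equiv.Perm.sign_swap (by simp)]
    simp

theorem sum_cup {m : ℕ} (M : Matrix (Fin m) (Fin m) R) :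
    ∑ σ : Equiv.Perm (Fin m ⊕ Fin m), ((Equiv.Perm.sign σ : ℤˣ) : ℤ) •
      (∏ t, Cup M (σ (Sum.inl t)) (σ (Sum.inr t))) = (m.factorial : R) * M.det := by
  classical
  have h1 : ∑ p : Equiv.Perm (Fin m) × Equiv.Perm (Fin m),
      ((Equiv.Perm.sign (p.1.sumCongr p.2) : ℤˣ) : ℤ) • ∏ t, M (p.1 t) (p.2 t) =
      ∑ σ : Equiv.Perm (Fin m ⊕ Fin m), ((Equiv.Perm.sign σ : ℤˣ) : ℤ) •
      (∏ t, Cup M (σ (Sum.inl t)) (σ (Sum.inr t))) := by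
    refine Finset.sum_of_injOn (fun p => p.1.sumCongr p.2) ?_ ?_ ?_ ?_
    · intro p _ q _ h
      exact Equiv.Perm.sumCongrHom_injective h
    · simp
    · intro σ _ hσ
      have h1 : ¬ Set.MapsTo σ (Set.range Sum.inl) (Set.range Sum.inl) := by
        intro hm
        obtain ⟨p, hp⟩ := Equiv.Perm.mem_sumCongrHom_range_of_perm_mapsTo_inl hm
        exact hσ ⟨p, by simp, hp⟩
      simp only [Set.MapsTo, Set.mem_range, forall_exists_index, forall_apply_eq_imp_iff] at h1
      push Not at h1
      obtain ⟨a, ha⟩ := h1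
      rw [Finset.prod_eq_zero (Finset.mem_univ a), smul_zero]
      rcases hx : σ (Sum.inl a) with b | b
      · exact absurd hx.symm (ha b)
      · simp [Cup]
    · intro p _
      simp [Cup]
  rw [← h1, Fintype.sum_prod_type]
  have h2 : ∀ α : Equiv.Perm (Fin m), ∑ β : Equiv.Perm (Fin m),
      ((Equiv.Perm.sign (α.sumCongr β) : ℤˣ) : ℤ) • ∏ t, M (α t) (β t) = M.det := by
    intro α
    have h3 := Matrix.det_permute α M
    rw [← Matrix.det_transpose, Matrix.det_apply'] at h3
    simp only [Matrix.transpose_apply, Matrix.submatrix_apply, id] at h3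
    have hs : (((Equiv.Perm.sign α : ℤˣ) : ℤ) : R) * ((Equiv.Perm.sign α : ℤˣ) : ℤ) = 1 := by
      rw [← Int.cast_mul, ← Units.val_mul, Int.units_mul_self]; simp
    calc _ = (((Equiv.Perm.sign α : ℤˣ) : ℤ) : R) * ∑ β : Equiv.Perm (Fin m),
          (((Equiv.Perm.sign β : ℤˣ) : ℤ) : R) * ∏ t, M (α t) (β t) := by
          rw [Finset.mul_sum]
          refine Finset.sum_congr rfl fun β _ => ?_
          rw [Equiv.Perm.sign_sumCongr, zsmul_eq_mul, Units.val_mul, Int.cast_mul, mul_assoc]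
      _ = M.det := by rw [h3, ← mul_assoc, hs, one_mul]
  simp only [h2]
  simp [Fintype.card_perm]

def posE (m : ℕ) : Fin m ⊕ Fin m ≃ Fin (m + m) where
  toFun := Sum.elim (fun t => ⟨2 * t, by omega⟩) (fun t => ⟨2 * t + 1, by omega⟩)
  invFun i := if (i : ℕ) % 2 = 0 then Sum.inl ⟨i / 2, by omega⟩ else Sum.inr ⟨i / 2, by omega⟩
  left_inv := by
    rintro (t | t)
    · simp
    · have h : ¬ (2 * (t : ℕ) + 1) % 2 = 0 := by omega
      have h' : (2 * (t : ℕ) + 1) / 2 = t := by omega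
      simp [h, h']
  right_inv := by
    intro i
    dsimp only
    split_ifs with h
    · ext; simp; omega
    · ext; simp; omega

def valE (m : ℕ) : Fin m ⊕ Fin m ≃ Fin (m + m) where
  toFun := Sum.elim (fun t => ⟨t, by omega⟩) (fun t => ⟨2 * m - 1 - t, by omega⟩)
  invFun i := if h : (i : ℕ) < m then Sum.inl ⟨i, h⟩ else Sum.inr ⟨2 * m - 1 - i, by omega⟩
  left_inv := by
    rintro (t | t)
    · simp
    · have h : ¬ (2 * m - 1 - (t : ℕ) < m) := by omega
      have h' : 2 * m - 1 - (2 * m - 1 - (t : ℕ)) = t := by omega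
      simp [h, h']
  right_inv := by
    intro i
    dsimp only
    split_ifs with h
    · ext; simp
    · ext; simp; omega

theorem base_sign (m : ℕ) : Equiv.Perm.sign ((posE m).symm.trans (valE m)) = 1 := by
  set e := (posE m).symm.trans (valE m) with he
  have hval : ∀ i, ((e i : Fin (m + m)) : ℕ) = if (i : ℕ) % 2 = 0 then (i : ℕ) / 2 else 2 * m - 1 - i / 2 := by
    intro i
    simp only [he, Equiv.trans_apply, posE, valE, Equiv.coe_fn_symm_mk, Equiv.coe_fn_mk]
    split_ifs <;> simp
  rw [Equiv.Perm.sign_eq_prod_prod_Iio]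
  have h1 : ∀ j : Fin (m + m), (∏ i ∈ Finset.Iio j, if e i < e j then (1 : ℤˣ) else -1) = (-1) ^ ((j : ℕ) / 2) := by
    intro j
    have h2 : (∏ i ∈ Finset.Iio j, if e i < e j then (1 : ℤˣ) else -1) =
        ∏ i ∈ Finset.range (j : ℕ), if i % 2 = 0 then (1 : ℤˣ) else -1 := by
      refine Finset.prod_bij (fun i _ => (i : ℕ)) ?_ ?_ ?_ ?_
      · intro i hi
        simpa using hi
      · intro a _ b _ h; exact Fin.ext h
      · intro b hb
        have hb := Finset.mem_range.mp hb
        exact ⟨⟨b, by omega⟩, by simpa [Fin.lt_def] using hb, rfl⟩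
      · intro i hi
        have hi : (i : ℕ) < j := by simpa using hi
        have : e i < e j ↔ (i : ℕ) % 2 = 0 := by
          rw [Fin.lt_def, hval, hval]
          split_ifs <;> omega
        simp only [this]
    rw [h2]
    generalize (j : ℕ) = n
    induction n with
    | zero => simp
    | succ n ih =>
      rw [Finset.prod_range_succ, ih]
      split_ifs with h
      · rw [mul_one]; congr 1; omega
      · rw [← pow_succ]; congr 1; omega
  simp only [h1]
  rw [← Equiv.prod_comp (posE m), Fintype.prod_sum_type, ← Finset.prod_mul_distrib]
  apply Finset.prod_eq_one
  intro t _
  simp only [posE, Equiv.coe_fn_mk, Sum.elim_inl, Sum.elim_inr]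
  have e1 : (2 * (t : ℕ)) / 2 = t := by omega
  have e2 : (2 * (t : ℕ) + 1) / 2 = t := by omega
  rw [e1, e2, Int.units_mul_self]

theorem pf_det [Algebra ℚ R] {m : ℕ} (B : Matrix (Fin (m + m)) (Fin (m + m)) R)
    (M : Matrix (Fin m) (Fin m) R)
    (hB : ∀ u v, B (valE m u) (valE m v) = Cup M u v - Cup M v u) :
    Pf B = M.det := by
  classical
  have hm : (m + m) / 2 = m := by omega
  have hsum : (∑ σ : Equiv.Perm (Fin (m + m)),
      ((Equiv.Perm.sign σ : ℤˣ) : ℤ) •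
        ∏ t ∈ (Finset.range ((m + m) / 2)).attach,
          B (σ ⟨2 * t.1, by have := Finset.mem_range.mp t.2; omega⟩)
            (σ ⟨2 * t.1 + 1, by have := Finset.mem_range.mp t.2; omega⟩)) =
      ∑ σ : Equiv.Perm (Fin m ⊕ Fin m), ((Equiv.Perm.sign σ : ℤˣ) : ℤ) •
      ∏ t, (Cup M (σ (Sum.inl t)) (σ (Sum.inr t)) - Cup M (σ (Sum.inr t)) (σ (Sum.inl t))) := by
    symm
    apply Fintype.sum_equiv (Equiv.equivCongr (posE m) (valE m))
    intro σ
    congr 1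
    · have : (Equiv.equivCongr (posE m) (valE m)) σ =
          ((posE m).symm.trans (valE m)) * (((posE m).symm.trans σ).trans (posE m)) := by
        ext x; simp [Equiv.equivCongr]
      rw [this, Equiv.Perm.sign_mul, base_sign, Equiv.Perm.sign_symm_trans_trans, one_mul]
    · symm
      refine Finset.prod_bij (fun t _ => ⟨t.1, by have := Finset.mem_range.mp t.2; omega⟩) ?_ ?_ ?_ ?_
      · simp
      · intro a _ b _ h
        exact Subtype.ext (by simpa using h)
      · intro b _
        exact ⟨⟨b, by simp [hm]⟩, by simp, rfl⟩
      · intro t _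
        rw [← hB]
        have ht := Finset.mem_range.mp t.2
        have e1 : (⟨2 * t.1, by omega⟩ : Fin (m + m)) = posE m (Sum.inl ⟨t.1, by omega⟩) := rfl
        have e2 : (⟨2 * t.1 + 1, by omega⟩ : Fin (m + m)) = posE m (Sum.inr ⟨t.1, by omega⟩) := rfl
        rw [e1, e2]
        simp [Equiv.equivCongr]
  rw [Pf, hsum, sum_swap M Finset.univ]
  simp only [Finset.compl_univ, Finset.prod_empty, mul_one]
  rw [sum_cup, hm, Finset.card_univ, Fintype.card_fin, ← mul_assoc]
  have : (2 : R) ^ m * (m.factorial : R) = algebraMap ℚ R (2 ^ m * m.factorial) := by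
    rw [map_mul, map_pow, map_ofNat, map_natCast]
  rw [this, ← Algebra.smul_def, smul_smul, inv_mul_cancel₀, one_smul]
  positivity

theorem pf_zero [Algebra ℚ R] {l m : ℕ} (B : Matrix (Fin (l + m)) (Fin (l + m)) R)
    (hlm : l ≠ m) (he : Even (l + m))
    (h1 : ∀ i j : Fin (l + m), (i : ℕ) < l → (j : ℕ) < l → B i j = 0)
    (h2 : ∀ i j : Fin (l + m), l ≤ (i : ℕ) → l ≤ (j : ℕ) → B i j = 0) : Pf B = 0 := by
  classical
  rw [Pf]
  rw [Finset.sum_eq_zero, smul_zero]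
  intro σ _
  by_contra hne
  have hp : ∀ t (ht : t < (l + m) / 2), ((σ ⟨2 * t, by omega⟩ : Fin _) : ℕ) < l ↔
      ¬ ((σ ⟨2 * t + 1, by omega⟩ : Fin _) : ℕ) < l := by
    intro t ht
    have : B (σ ⟨2 * t, by omega⟩) (σ ⟨2 * t + 1, by omega⟩) ≠ 0 := by
      intro h0
      apply hne
      rw [Finset.prod_eq_zero (Finset.mem_attach _ ⟨t, Finset.mem_range.mpr ht⟩) h0, smul_zero]
    constructor
    · intro ha hb; exact this (h1 _ _ ha hb)
    · intro hb; by_contra ha; exact this (h2 _ _ (by omega) (by omega))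
  -- count the positions sent into the first block
  let f : ℕ → ℕ := fun i => if h : i < l + m then (if ((σ ⟨i, h⟩ : Fin _) : ℕ) < l then 1 else 0) else 0
  have hf : ∀ n, n ≤ (l + m) / 2 → ∑ i ∈ Finset.range (2 * n), f i = n := by
    intro n
    induction n with
    | zero => simp
    | succ n ih =>
      intro hn
      rw [show 2 * (n + 1) = 2 * n + 1 + 1 by ring, Finset.sum_range_succ, Finset.sum_range_succ,
        ih (by omega)]
      have := hp n (by omega)
      simp only [f]
      rw [dif_pos (by omega), dif_pos (by omega)]
      split_ifs <;> first | omega | (exfalso; tauto)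
  have hN : 2 * ((l + m) / 2) = l + m := by obtain ⟨k, hk⟩ := he; omega
  have h3 := hf _ le_rfl
  rw [hN, Finset.sum_range] at h3
  have h4 : ∑ i : Fin (l + m), f i = ∑ i : Fin (l + m), if (i : ℕ) < l then 1 else 0 := by
    rw [← Equiv.sum_comp σ (fun i : Fin (l + m) => if (i : ℕ) < l then 1 else 0)]
    refine Finset.sum_congr rfl fun i _ => ?_
    simp [f]
  rw [h4, Fin.sum_univ_add] at h3
  simp at h3
  omega

theorem map_Pf {S : Type*} [CommRing S] [Algebra ℚ R] [Algebra ℚ S] (g : R →ₐ[ℚ] S) {N : ℕ}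
    (B : Matrix (Fin N) (Fin N) R) : g (Pf B) = Pf (B.map g) := by
  simp [Pf, map_smul, map_sum, map_prod, map_zsmul]

end pf

theorem SPartn.len_le (lam mu : SPartn) (h : mu.Sub lam) : mu.len ≤ lam.len := by
  apply Nat.find_min'
  have h1 := h lam.len
  have h2 : lam.part lam.len = 0 := Nat.find_spec lam.exists_zero
  omega

theorem SPartn.part_pos (lam : SPartn) {i : ℕ} (h : i < lam.len) : 0 < lam.part i :=
  Nat.pos_of_ne_zero (Nat.find_min lam.exists_zero h)

/-- One-variable specialization of the skew symplectic `Q`-function: it vanishes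
when `ℓ(λ) − ℓ(μ) > 1`, and otherwise is given by the determinant
`det[q_{λ_i − μ_j}]_{i,j=1}^{ℓ(λ)}` (with `μ` padded by zero parts). -/
theorem piC1_QCskew (lam mu : SPartn) (hsub : mu.Sub lam) :
    (1 < lam.len - mu.len → piC1 (QCskew lam mu) = 0) ∧
    (lam.len - mu.len ≤ 1 →
      piC1 (QCskew lam mu) =
        Matrix.det (Matrix.of fun i j : Fin lam.len =>
          piC1 (qZ ((lam.part i : ℤ) - (mu.part j : ℤ))))) := by
  have hle := SPartn.len_le lam mu hsub
  unfold QCskew skewQ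
  dsimp only
  rw [map_Pf]
  have hev : Even (lam.len + if Even (lam.len + mu.len) then mu.len else mu.len + 1) := by
    split_ifs with h
    · exact h
    · rw [← add_assoc]; exact (Nat.not_even_iff_odd.mp h).add_one
  have hm1 : mu.len ≤ if Even (lam.len + mu.len) then mu.len else mu.len + 1 := by
    split_ifs <;> omega
  have hm2 : (if Even (lam.len + mu.len) then mu.len else mu.len + 1) ≤ mu.len + 1 := by
    split_ifs <;> omega
  generalize (if Even (lam.len + mu.len) then mu.len else mu.len + 1) = m at *
  constructor
  · intro h
    apply pf_zero _ (by omega) hev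
    · intro i j hi hj
      simp only [Matrix.map_apply, Matrix.of_apply]
      rw [dif_pos hi, dif_pos hj]
      exact QC2_zero _ _ (lam.part_pos hj) (lam.part_pos hi)
    · intro i j hi hj
      simp only [Matrix.map_apply, Matrix.of_apply]
      rw [dif_neg (by omega), dif_neg (by omega), map_zero]
  · intro h
    obtain rfl : m = lam.len := by obtain ⟨k, hk⟩ := hev; omega
    apply pf_det
    rintro (a | a) (b | b)
    · simp [valE, Cup, QC2_zero _ _ (lam.part_pos b.2) (lam.part_pos a.2)]
    · have e1 : ¬ (2 * lam.len - 1 - (b : ℕ) < lam.len) := by omega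
      have e2 : lam.len - 1 - (2 * lam.len - 1 - (b : ℕ) - lam.len) = b := by omega
      simp [valE, Cup, e1, e2]
    · have e1 : ¬ (2 * lam.len - 1 - (a : ℕ) < lam.len) := by omega
      have e2 : lam.len - 1 - (2 * lam.len - 1 - (a : ℕ) - lam.len) = a := by omega
      simp [valE, Cup, e1, e2]
    · have e1 : ¬ (2 * lam.len - 1 - (a : ℕ) < lam.len) := by omega
      have e2 : ¬ (2 * lam.len - 1 - (b : ℕ) < lam.len) := by omega
      simp [valE, Cup, e1, e2]

end
end
end
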